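/- Commutator quadrilinear estimate in ℝ^{3+1} (summed form). Let s ∈ (5/6, 1) and let ε > 0 be sufficiently small. There is a constant C = C(s, ε, m₁) such that for every N ≥ 1, every δ ∈ (0,1], and all Schwartz functions φ₁, φ₂, φ₃, φ₄ on ℝ³ × ℝ whose spatial Fourier transforms φ̂ᵢ(·,t) are nonnegative for every t, one has |∫₀^δ ∫_{ξ₁+ξ₂+ξ₃+ξ₄=0} (1 − m_N(ξ₂+ξ₃+ξ₄)/(m_N(ξ₂) m_N(ξ₃) m_N(ξ₄))) φ̂₁(ξ₁,t) φ̂₂(ξ₂,t) φ̂₃(ξ₃,t) φ̂₄(ξ₄,t) dt| ≤ C N^{−1+ε} ‖φ₁‖_{X_{−1, 1/2+ε}} ‖∇φ₂‖_{X_{0, 1/2+ε}} ‖∇φ₃‖_{X_{0, 1/2+ε}} ‖∇φ₄‖_{X_{0, 1/2+ε}}. -/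

import Mathlib

open MeasureTheory Complex Set
open scoped FourierTransform BigOperators RealInnerProductSpace

noncomputable section

abbrev Rn (n : ℕ) := EuclideanSpace ℝ (Fin n)

/-- Japanese bracket of a vector. -/
def jap {n : ℕ} (ξ : Rn n) : ℝ := Real.sqrt (1 + ‖ξ‖ ^ 2)

/-- Japanese bracket of a real number. -/
def japR (x : ℝ) : ℝ := Real.sqrt (1 + x ^ 2)

/-- Inhomogeneous Sobolev norm ‖⟨ξ⟩^s f̂‖_{L²}. -/
def sobNorm (n : ℕ) (s : ℝ) (f : Rn n → ℂ) : ℝ :=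
  (∫ ξ : Rn n, jap ξ ^ (2 * s) * ‖𝓕 f ξ‖ ^ 2) ^ (1/2 : ℝ)

/-- Homogeneous Sobolev norm ‖|ξ|^s f̂‖_{L²}. -/
def sobNormHom (n : ℕ) (s : ℝ) (f : Rn n → ℂ) : ℝ :=
  (∫ ξ : Rn n, ‖ξ‖ ^ (2 * s) * ‖𝓕 f ξ‖ ^ 2) ^ (1/2 : ℝ)

/-- L^p norm on ℝⁿ. -/
def lpNorm (n : ℕ) (p : ℝ) (f : Rn n → ℂ) : ℝ :=
  (∫ x : Rn n, ‖f x‖ ^ p) ^ (1/p)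

/-- Laplacian: sum of second partial derivatives. -/
def laplacian {n : ℕ} (f : Rn n → ℂ) (x : Rn n) : ℂ :=
  ∑ i : Fin n, fderiv ℝ (fun y => fderiv ℝ f y (EuclideanSpace.single i 1)) x
    (EuclideanSpace.single i 1)

/-- Complex gradient as a vector in Euclidean space. -/
def gradC {n : ℕ} (f : Rn n → ℂ) (x : Rn n) : EuclideanSpace ℂ (Fin n) :=
  (WithLp.equiv 2 (Fin n → ℂ)).symm fun i => fderiv ℝ f x (EuclideanSpace.single i 1)

/-- φ is a solution of the cubic defocussing NLS on ℝⁿ × [0,T] with data φ₀: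
smooth, Schwartz in x uniformly for t ∈ [0,T] (with all derivatives),
satisfying i∂ₜφ + Δφ = |φ|²φ and φ(·,0) = φ₀. -/
def IsNLSSolution (n : ℕ) (T : ℝ) (φ : Rn n → ℝ → ℂ) (φ₀ : Rn n → ℂ) : Prop :=
  ContDiff ℝ (⊤ : ℕ∞) (fun p : Rn n × ℝ => φ p.1 p.2) ∧
  (∀ k l : ℕ, ∃ C : ℝ, ∀ t ∈ Icc (0:ℝ) T, ∀ x : Rn n,
      ‖x‖ ^ k * ‖iteratedFDeriv ℝ l (fun y => φ y t) x‖ ≤ C) ∧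
  (∀ x : Rn n, ∀ t ∈ Icc (0:ℝ) T,
      Complex.I * deriv (fun t' => φ x t') t + laplacian (fun y => φ y t) x
        = (‖φ x t‖ : ℂ) ^ 2 * φ x t) ∧
  (∀ x : Rn n, φ x 0 = φ₀ x)

/-- The energy E(f) = ∫ (1/2)|∇f|² + (1/4)|f|⁴. -/
def energy {n : ℕ} (f : Rn n → ℂ) : ℝ :=
  ∫ x : Rn n, ((1/2 : ℝ) * ∑ i : Fin n, ‖fderiv ℝ f x (EuclideanSpace.single i 1)‖ ^ 2
    + (1/4 : ℝ) * ‖f x‖ ^ 4)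

/-- m₁ is a smooth, radially symmetric, nonincreasing multiplier with
m₁ = 1 on the unit ball, m₁(ξ) = |ξ|^{-(1-s)} for |ξ| ≥ 2, 0 < m₁ ≤ 1. -/
def IsAdmissibleMultiplier (n : ℕ) (s : ℝ) (m₁ : Rn n → ℝ) : Prop :=
  ContDiff ℝ (⊤ : ℕ∞) m₁ ∧
  (∀ ξ : Rn n, 0 < m₁ ξ ∧ m₁ ξ ≤ 1) ∧
  (∀ ξ η : Rn n, ‖ξ‖ = ‖η‖ → m₁ ξ = m₁ η) ∧
  (∀ ξ η : Rn n, ‖ξ‖ ≤ ‖η‖ → m₁ η ≤ m₁ ξ) ∧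
  (∀ ξ : Rn n, ‖ξ‖ ≤ 1 → m₁ ξ = 1) ∧
  (∀ ξ : Rn n, 2 ≤ ‖ξ‖ → m₁ ξ = ‖ξ‖ ^ (-(1 - s)))

/-- The rescaled multiplier m_N(ξ) = m₁(ξ/N). -/
def mN {n : ℕ} (m₁ : Rn n → ℝ) (N : ℝ) (ξ : Rn n) : ℝ := m₁ (N⁻¹ • ξ)

/-- The smoothing operator I_N with Fourier multiplier m_N. -/
def Iop {n : ℕ} (m₁ : Rn n → ℝ) (N : ℝ) (f : Rn n → ℂ) : Rn n → ℂ :=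
  fun x => 𝓕⁻ (fun ξ => (mN m₁ N ξ : ℂ) * 𝓕 f ξ) x

/-- The spatial multiplier ⟨∇⟩^s. -/
def japMul (n : ℕ) (s : ℝ) (f : Rn n → ℂ) : Rn n → ℂ :=
  fun x => 𝓕⁻ (fun ξ => ((jap ξ ^ s : ℝ) : ℂ) * 𝓕 f ξ) x

/-- Sharp Littlewood–Paley projection onto {M ≤ ⟨ξ⟩ ≤ 2M}. -/
def LP (n : ℕ) (M : ℝ) (f : Rn n → ℂ) : Rn n → ℂ :=
  fun x => 𝓕⁻ (fun ξ => if M ≤ jap ξ ∧ jap ξ ≤ 2 * M then 𝓕 f ξ else 0) x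

/-- Space-time Fourier transform ψ̃(ξ,τ). -/
def stFourier (n : ℕ) {E : Type*} [NormedAddCommGroup E] [NormedSpace ℂ E]
    (ψ : Rn n → ℝ → E) (ξ : Rn n) (τ : ℝ) : E :=
  ∫ x : Rn n, ∫ t : ℝ,
    Complex.exp (Complex.I * ((-2 * Real.pi * (⟪x, ξ⟫ + t * τ) : ℝ) : ℂ)) • ψ x t

/-- The X_{s,b} norm ‖⟨ξ⟩^s ⟨τ-|ξ|²⟩^b ψ̃‖_{L²}. -/
def XNorm (n : ℕ) {E : Type*} [NormedAddCommGroup E] [NormedSpace ℂ E]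
    (s b : ℝ) (ψ : Rn n → ℝ → E) : ℝ :=
  (∫ ξ : Rn n, ∫ τ : ℝ,
    jap ξ ^ (2 * s) * japR (τ - ‖ξ‖ ^ 2) ^ (2 * b) * ‖stFourier n ψ ξ τ‖ ^ 2) ^ (1/2 : ℝ)

/-- The restricted norm X^δ_{s,b}: infimum over Schwartz extensions off ℝⁿ × [0,δ]. -/
def XRNorm (n : ℕ) {E : Type*} [NormedAddCommGroup E] [NormedSpace ℂ E]
    (s b δ : ℝ) (f : Rn n → ℝ → E) : ℝ :=
  sInf { r : ℝ | ∃ ψ : SchwartzMap (Rn n × ℝ) E,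
    (∀ x : Rn n, ∀ t ∈ Icc (0:ℝ) δ, ψ (x, t) = f x t) ∧
    r = XNorm n s b (fun x t => ψ (x, t)) }

/-- Space-time L^p norm on ℝⁿ × ℝ. -/
def lpNormST (n : ℕ) {E : Type*} [NormedAddCommGroup E] (p : ℝ) (F : Rn n → ℝ → E) : ℝ :=
  (∫ t : ℝ, ∫ x : Rn n, ‖F x t‖ ^ p) ^ (1/p)

/-- Space-time L^p norm on ℝⁿ × [0,δ]. -/
def lpNormSTt (n : ℕ) {E : Type*} [NormedAddCommGroup E] (p δ : ℝ) (F : Rn n → ℝ → E) : ℝ :=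
  (∫ t in Icc (0:ℝ) δ, ∫ x : Rn n, ‖F x t‖ ^ p) ^ (1/p)

lemma one_le_japR (x : ℝ) : 1 ≤ japR x := by
  rw [japR, Real.le_sqrt' one_pos]; nlinarith [sq_nonneg x]

lemma japR_pos (x : ℝ) : 0 < japR x := one_pos.trans_le (one_le_japR x)

lemma one_le_jap {n : ℕ} (x : Rn n) : 1 ≤ jap x := by
  rw [jap, Real.le_sqrt' one_pos]; nlinarith [sq_nonneg ‖x‖]

lemma jap_pos {n : ℕ} (x : Rn n) : 0 < jap x := one_pos.trans_le (one_le_jap x)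

@[fun_prop] lemma continuous_japR : Continuous japR := by
  unfold japR; fun_prop

@[fun_prop] lemma continuous_jap {n : ℕ} : Continuous (jap : Rn n → ℝ) := by
  unfold jap; fun_prop

@[fun_prop] lemma measurable_japR : Measurable japR := continuous_japR.measurable

@[fun_prop] lemma measurable_jap {n : ℕ} : Measurable (jap : Rn n → ℝ) :=
  continuous_jap.measurable

lemma japR_rpow_neg_le_one {q : ℝ} (hq : 0 ≤ q) (x : ℝ) : japR x ^ (-q) ≤ 1 :=
  Real.rpow_le_one_of_one_le_of_nonpos (one_le_japR x) (by linarith)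

lemma lintegral_japR_rpow_neg_lt_top {q : ℝ} (hq : 1 < q) :
    ∫⁻ x : ℝ, ENNReal.ofReal (japR x ^ (-q)) < ⊤ := by
  have h := integrable_rpow_neg_one_add_norm_sq (E := ℝ) (μ := volume) (r := q) (by simpa using hq)
  have hx : ∀ x, japR x ^ (-q) = (1 + ‖x‖ ^ 2) ^ (-q / 2) := fun x => by
    rw [japR, Real.sqrt_eq_rpow, ← Real.rpow_mul (by positivity), Real.norm_eq_abs, sq_abs]
    congr 1
    ring
  simpa only [hx] using h.lintegral_lt_top

/-- Change of variables `u = A + 2 v²`. -/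
lemma lintegral_comp_quadratic_le (g : ℝ → ENNReal) (A : ℝ) :
    ∫⁻ v : ℝ, ENNReal.ofReal |v| * g (A + 2 * v ^ 2) ≤ ∫⁻ u, g u := by
  have key : ∀ S : Set ℝ, MeasurableSet S → InjOn (fun v : ℝ => A + 2 * v ^ 2) S →
      4 * ∫⁻ v in S, ENNReal.ofReal |v| * g (A + 2 * v ^ 2) ≤ ∫⁻ u, g u := by
    intro S hS hinj
    have := lintegral_image_eq_lintegral_abs_deriv_mul (f := fun v : ℝ => A + 2 * v ^ 2)
      (f' := fun v => 4 * v) hS (fun x _ => by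
        have := (((hasDerivAt_pow 2 x).const_mul 2).const_add A).hasDerivWithinAt (s := S)
        exact this.congr_deriv (by push_cast; ring)) hinj g
    calc 4 * ∫⁻ v in S, ENNReal.ofReal |v| * g (A + 2 * v ^ 2)
        = ∫⁻ v in S, ENNReal.ofReal |4 * v| * g (A + 2 * v ^ 2) := by
          rw [← lintegral_const_mul' _ _ (by simp)]
          congr 1 with v
          rw [abs_mul, ENNReal.ofReal_mul (by positivity)]
          simp [mul_assoc]
      _ = _ := this.symm
      _ ≤ _ := setLIntegral_le_lintegral _ _
  have h1 := key (Ioi 0) measurableSet_Ioi (by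
    intro x hx y hy hxy
    simp only [mem_Ioi] at hx hy
    have : x ^ 2 = y ^ 2 := by simpa using hxy
    exact (pow_left_inj₀ hx.le hy.le two_ne_zero).1 this)
  have h2 := key (Iic 0) measurableSet_Iic (by
    intro x hx y hy hxy
    simp only [mem_Iic] at hx hy
    have : x ^ 2 = y ^ 2 := by simpa using hxy
    nlinarith [(sq_eq_sq_iff_abs_eq_abs x y).1 this, abs_of_nonpos hx, abs_of_nonpos hy])
  rw [← lintegral_add_compl (μ := volume) _ (measurableSet_Ioi (a := (0:ℝ))), compl_Ioi]
  have : (4:ENNReal) * ((∫⁻ v in Ioi 0, ENNReal.ofReal |v| * g (A + 2 * v ^ 2)) +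
      ∫⁻ v in Iic 0, ENNReal.ofReal |v| * g (A + 2 * v ^ 2)) ≤ 4 * ∫⁻ u, g u := by
    rw [mul_add]
    refine (add_le_add h1 h2).trans ?_
    rw [← two_mul]
    gcongr
    norm_num
  exact (ENNReal.mul_le_mul_iff_right (by simp) (by simp)).1 this

/-- Finite integral from finite half-line integral, for even functions. -/
lemma lintegral_lt_top_of_even {g : ℝ → ENNReal} (hg : ∀ x, g (-x) = g x)
    (h : ∫⁻ x in Ioi 0, g x < ⊤) : ∫⁻ x, g x < ⊤ := by
  rw [← lintegral_add_compl (μ := volume) _ (measurableSet_Ioi (a := (0:ℝ))), compl_Ioi]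
  refine ENNReal.add_lt_top.2 ⟨h, ?_⟩
  rw [setLIntegral_congr (Iio_ae_eq_Iic (a := (0:ℝ))).symm]
  have : ∫⁻ x in Iio 0, g x = ∫⁻ x in Ioi 0, g x := by
    have := (Measure.measurePreserving_neg (volume : Measure ℝ)).setLIntegral_comp_preimage_emb
      (MeasurableEquiv.neg ℝ).measurableEmbedding g (Iio 0)
    simp only [hg] at this
    rw [← this]
    congr 2
    ext; simp
  rwa [this]

lemma lintegral_abs_rpow_ball_lt_top {r : ℝ} (hr : -1 < r) :
    ∫⁻ x : ℝ, (Icc (-1:ℝ) 1).indicator (fun x => ENNReal.ofReal (|x| ^ r)) x < ⊤ := by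
  refine lintegral_lt_top_of_even ?_ ?_
  · intro x
    simp only [indicator_apply, mem_Icc, abs_neg]
    congr 1
    exact propext ⟨fun h => ⟨by linarith [h.2], by linarith [h.1]⟩,
      fun h => ⟨by linarith [h.2], by linarith [h.1]⟩⟩
  · have h := (intervalIntegral.intervalIntegrable_rpow' (a := 0) (b := 1) hr).1.lintegral_lt_top
    refine lt_of_le_of_lt ?_ h
    rw [lintegral_indicator measurableSet_Icc, Measure.restrict_restrict measurableSet_Icc]
    rw [show Icc (-1:ℝ) 1 ∩ Ioi 0 = Ioc 0 1 by ext; simp; constructor <;> intro h <;> grind]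
    refine (setLIntegral_congr_fun measurableSet_Ioc fun x hx => ?_).le
    rw [abs_of_pos hx.1]

/-- Comparison weight, integrable on the line. -/
def kap (θ x : ℝ) : ℝ := |x| ^ (-1 + θ / 4) * japR x ^ (-(θ / 2))

lemma kap_nonneg (θ x : ℝ) : 0 ≤ kap θ x :=
  mul_nonneg (by positivity) (Real.rpow_nonneg (japR_pos x).le _)

@[fun_prop] lemma measurable_kap (θ : ℝ) : Measurable (kap θ) := by
  unfold kap; fun_prop

lemma abs_le_japR (x : ℝ) : |x| ≤ japR x := by
  rw [japR]; exact Real.abs_le_sqrt (by linarith)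

lemma lintegral_kap_lt_top {θ : ℝ} (hθ : 0 < θ) : ∫⁻ x, ENNReal.ofReal (kap θ x) < ⊤ := by
  refine lintegral_lt_top_of_even (fun x => by simp [kap, japR]) ?_
  rw [← Ioc_union_Ioi_eq_Ioi (zero_le_one' ℝ)]
  refine (lintegral_union_le _ _ _).trans_lt (ENNReal.add_lt_top.2 ⟨?_, ?_⟩)
  · refine lt_of_le_of_lt ?_ (intervalIntegral.intervalIntegrable_rpow' (a := 0) (b := 1)
      (r := -1 + θ / 4) (by linarith)).1.lintegral_lt_top
    refine setLIntegral_mono' measurableSet_Ioc fun x hx => ENNReal.ofReal_le_ofReal ?_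
    rw [kap, abs_of_pos hx.1]
    exact mul_le_of_le_one_right (Real.rpow_nonneg hx.1.le _)
      (japR_rpow_neg_le_one (by linarith) x)
  · refine lt_of_le_of_lt ?_ (integrableOn_Ioi_rpow_of_lt (a := -1 - θ / 4) (c := 1)
      (by linarith) (zero_lt_one' ℝ)).lintegral_lt_top
    refine setLIntegral_mono' measurableSet_Ioi fun x hx => ENNReal.ofReal_le_ofReal ?_
    have hx0 : 0 < x := (zero_lt_one' ℝ).trans hx
    rw [kap, abs_of_pos hx0, show -1 - θ / 4 = (-1 + θ / 4) + (-(θ/2)) by ring,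
      Real.rpow_add hx0 (-1 + θ / 4) (-(θ / 2))]
    exact mul_le_mul_of_nonneg_left (Real.rpow_le_rpow_of_nonpos hx0
      ((le_abs_self x).trans (abs_le_japR x)) (by linarith)) (Real.rpow_nonneg hx0.le _)

/-- One-dimensional resonance integral, uniformly in the translations. -/
lemma exists_lintegral_resonance_le {q : ℝ} (hq : 1 < q) :
    ∃ K : ENNReal, K < ⊤ ∧ ∀ A c : ℝ,
      ∫⁻ v : ℝ, ENNReal.ofReal (japR (A + 2 * v ^ 2) ^ (-q) *
        (1 + |v| + |v - c| ^ (-(1/2) : ℝ))) ≤ K := by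
  set I := fun x : ℝ => (Icc (-1:ℝ) 1).indicator (fun x => ENNReal.ofReal (|x| ^ (0:ℝ))) x
  set L := fun x : ℝ => (Icc (-1:ℝ) 1).indicator (fun x => ENNReal.ofReal (|x| ^ (-(1/2):ℝ))) x
  have hI : ∫⁻ x, I x < ⊤ := lintegral_abs_rpow_ball_lt_top (by norm_num)
  have hL : ∫⁻ x, L x < ⊤ := lintegral_abs_rpow_ball_lt_top (by norm_num)
  set W := fun u : ℝ => ENNReal.ofReal (japR u ^ (-q))
  have hW : ∫⁻ u, W u < ⊤ := lintegral_japR_rpow_neg_lt_top hq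
  have mI : Measurable I := by
    refine Measurable.indicator ?_ measurableSet_Icc; fun_prop
  have mL : Measurable L := by
    refine Measurable.indicator ?_ measurableSet_Icc; fun_prop
  have mW : Measurable W := by fun_prop
  refine ⟨2 * (∫⁻ x, I x) + 3 * (∫⁻ u, W u) + ∫⁻ x, L x, ?_, fun A c => ?_⟩
  · exact ENNReal.add_lt_top.2 ⟨ENNReal.add_lt_top.2 ⟨ENNReal.mul_lt_top (by simp) hI,
      ENNReal.mul_lt_top (by simp) hW⟩, hL⟩
  calc _ ≤ ∫⁻ v : ℝ, (2 * I v + 3 * (ENNReal.ofReal |v| * W (A + 2 * v ^ 2)) + L (v - c)) := by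
        refine lintegral_mono fun v => ?_
        set w := japR (A + 2 * v ^ 2) ^ (-q)
        have hw0 : 0 ≤ w := Real.rpow_nonneg (japR_pos _).le _
        have hw1 : w ≤ 1 := japR_rpow_neg_le_one (by linarith) _
        have e1 : ENNReal.ofReal w ≤ I v + ENNReal.ofReal |v| * ENNReal.ofReal w := by
          by_cases hv : v ∈ Icc (-1:ℝ) 1
          · simp only [I, indicator_of_mem hv, Real.rpow_zero]
            exact (ENNReal.ofReal_le_ofReal hw1).trans le_self_add
          · have : 1 ≤ |v| := by
              by_contra! h; exact hv (abs_le.1 h.le)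
            refine le_trans ?_ le_add_self
            rw [← ENNReal.ofReal_mul (abs_nonneg v)]
            exact ENNReal.ofReal_le_ofReal (le_mul_of_one_le_left hw0 this)
        have e2 : ENNReal.ofReal (w * |v - c| ^ (-(1/2) : ℝ)) ≤ L (v - c) + ENNReal.ofReal w := by
          by_cases hv : v - c ∈ Icc (-1:ℝ) 1
          · simp only [L, indicator_of_mem hv]
            refine le_trans (ENNReal.ofReal_le_ofReal ?_) le_self_add
            exact mul_le_of_le_one_left (by positivity) hw1
          · have : 1 ≤ |v - c| := by
              by_contra! h; exact hv (abs_le.1 h.le)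
            refine le_trans (ENNReal.ofReal_le_ofReal ?_) le_add_self
            exact mul_le_of_le_one_right hw0
              (Real.rpow_le_one_of_one_le_of_nonpos this (by norm_num))
        have : ENNReal.ofReal (w * (1 + |v| + |v - c| ^ (-(1/2) : ℝ))) =
            ENNReal.ofReal w + ENNReal.ofReal |v| * ENNReal.ofReal w +
              ENNReal.ofReal (w * |v - c| ^ (-(1/2) : ℝ)) := by
          rw [← ENNReal.ofReal_mul (abs_nonneg v), ← ENNReal.ofReal_add hw0 (by positivity),
            ← ENNReal.ofReal_add (by positivity) (by positivity)]
          congr 1; ring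
        rw [this]
        calc _ ≤ (I v + ENNReal.ofReal |v| * ENNReal.ofReal w) +
              ENNReal.ofReal |v| * ENNReal.ofReal w + (L (v - c) +
              (I v + ENNReal.ofReal |v| * ENNReal.ofReal w)) := by
              gcongr; exact e2.trans (by gcongr)
          _ = _ := by simp only [W]; ring
    _ = 2 * (∫⁻ v, I v) + 3 * (∫⁻ v : ℝ, ENNReal.ofReal |v| * W (A + 2 * v ^ 2)) +
          ∫⁻ v, L (v - c) := by
        rw [lintegral_add_left (by fun_prop), lintegral_add_left (by fun_prop),
          lintegral_const_mul _ mI, lintegral_const_mul _ (by fun_prop)]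
    _ ≤ _ := by
        exact add_le_add (add_le_add le_rfl (mul_le_mul' le_rfl
          (lintegral_comp_quadratic_le W A))) (lintegral_sub_right_eq_self L c).le

lemma abs_apply_le_norm {n : ℕ} (x : Rn n) (i : Fin n) : |x i| ≤ ‖x‖ := by
  simpa using PiLp.norm_apply_le x i

lemma norm_le_jap {n : ℕ} (x : Rn n) : ‖x‖ ≤ jap x := by
  rw [jap]; exact Real.le_sqrt_of_sq_le (by linarith)

lemma japR_apply_le_jap {n : ℕ} (x : Rn n) (i : Fin n) : japR (x i) ≤ jap x := by
  rw [japR, jap]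
  refine Real.sqrt_le_sqrt ?_
  have := abs_apply_le_norm x i
  nlinarith [sq_abs (x i), abs_nonneg (x i), norm_nonneg x]

lemma exists_jap_le (v : Rn 3) : ∃ j, jap v ≤ 3 * (1 + |v j|) := by
  obtain ⟨j, hj⟩ := Finite.exists_max fun j => |v j|
  refine ⟨j, ?_⟩
  rw [jap]
  refine Real.sqrt_le_iff.2 ⟨by positivity, ?_⟩
  rw [EuclideanSpace.norm_sq_eq, Fin.sum_univ_three]
  simp only [Real.norm_eq_abs]
  have := hj 0; have := hj 1; have := hj 2
  have a := abs_nonneg (v 0); have := abs_nonneg (v 1); have := abs_nonneg (v 2)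
  have := abs_nonneg (v j)
  nlinarith [pow_le_pow_left₀ a (hj 0) 2, pow_le_pow_left₀ (abs_nonneg (v 1)) (hj 1) 2,
    pow_le_pow_left₀ (abs_nonneg (v 2)) (hj 2) 2]

/-- Splitting of the three-dimensional weight into one-dimensional ones. -/
lemma jap_weight_le_sum {θ : ℝ} (h0 : 0 < θ) (h1 : θ < 1) (v x : Rn 3) (hx : ∀ i, x i ≠ 0) :
    jap v ^ (1 - θ) * (‖x‖ ^ 2)⁻¹ * jap x ^ (-θ) ≤
      3 * ∑ j, (1 + |v j| + |x j| ^ (-(1/2) : ℝ)) * ∏ i : Fin 2, kap θ (x (j.succAbove i)) := by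
  obtain ⟨j, hj⟩ := exists_jap_le v
  have hterm : ∀ j, 0 ≤ (1 + |v j| + |x j| ^ (-(1/2) : ℝ)) *
      ∏ i : Fin 2, kap θ (x (j.succAbove i)) := fun j =>
    mul_nonneg (by positivity) (Finset.prod_nonneg fun _ _ => kap_nonneg _ _)
  refine le_trans ?_ (mul_le_mul_of_nonneg_left
    (Finset.single_le_sum (fun j _ => hterm j) (Finset.mem_univ j)) (by norm_num))
  have hpos : ∀ i, 0 < |x i| := fun i => abs_pos.2 (hx i)
  have hn : 0 < ‖x‖ := (hpos 0).trans_le (abs_apply_le_norm x 0)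
  set a := j.succAbove 0
  set b := j.succAbove 1
  have e1 : jap v ^ (1 - θ) ≤ 3 * (1 + |v j|) ^ (1 - θ) := by
    calc jap v ^ (1 - θ) ≤ (3 * (1 + |v j|)) ^ (1 - θ) :=
          Real.rpow_le_rpow (jap_pos v).le hj (by linarith)
      _ = 3 ^ (1 - θ) * (1 + |v j|) ^ (1 - θ) := Real.mul_rpow (by norm_num) (by positivity)
      _ ≤ 3 ^ (1 : ℝ) * (1 + |v j|) ^ (1 - θ) := by
          gcongr <;> linarith
      _ = _ := by rw [Real.rpow_one]
  have e2 : (‖x‖ ^ 2)⁻¹ ≤ |x j| ^ (-(θ/2)) * |x a| ^ (-1 + θ/4) * |x b| ^ (-1 + θ/4) := by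
    have : (‖x‖ ^ 2)⁻¹ = ‖x‖ ^ (-(θ/2)) * ‖x‖ ^ (-1 + θ/4) * ‖x‖ ^ (-1 + θ/4) := by
      rw [← Real.rpow_add hn, ← Real.rpow_add hn, ← Real.rpow_natCast, ← Real.rpow_neg hn.le]
      congr 1; push_cast; ring
    rw [this]
    have hle : ∀ i (r : ℝ), r ≤ 0 → ‖x‖ ^ r ≤ |x i| ^ r := fun i r hr =>
      Real.rpow_le_rpow_of_nonpos (hpos i) (abs_apply_le_norm x i) hr
    have p : ∀ (r : ℝ), 0 ≤ ‖x‖ ^ r := fun r => Real.rpow_nonneg hn.le r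
    have p' : ∀ i (r : ℝ), 0 ≤ |x i| ^ r := fun i r => Real.rpow_nonneg (hpos i).le r
    exact mul_le_mul (mul_le_mul (hle j _ (by linarith)) (hle a _ (by linarith)) (p _) (p' _ _))
      (hle b _ (by linarith)) (p _) (mul_nonneg (p' _ _) (p' _ _))
  have e3 : jap x ^ (-θ) ≤ japR (x a) ^ (-(θ/2)) * japR (x b) ^ (-(θ/2)) := by
    rw [show -θ = -(θ/2) + -(θ/2) by ring, Real.rpow_add (jap_pos x)]
    have hle : ∀ i, jap x ^ (-(θ/2)) ≤ japR (x i) ^ (-(θ/2)) := fun i =>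
      Real.rpow_le_rpow_of_nonpos (japR_pos _) (japR_apply_le_jap x i) (by linarith)
    exact mul_le_mul (hle a) (hle b) (Real.rpow_nonneg (jap_pos x).le _)
      (Real.rpow_nonneg (japR_pos _).le _)
  have e4 : (1 + |v j|) ^ (1 - θ) * |x j| ^ (-(θ/2)) ≤ 1 + |v j| + |x j| ^ (-(1/2) : ℝ) := by
    have := Real.geom_mean_le_arith_mean2_weighted (w₁ := 1 - θ) (w₂ := θ) (p₁ := 1 + |v j|)
      (p₂ := |x j| ^ (-(1/2) : ℝ)) (by linarith) h0.le (by positivity) (by positivity) (by ring)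
    rw [← Real.rpow_mul (hpos j).le, show -(1/2) * θ = -(θ/2) by ring] at this
    refine this.trans (add_le_add ?_ ?_)
    · exact mul_le_of_le_one_left (by positivity) (by linarith)
    · exact mul_le_of_le_one_left (by positivity) h1.le
  have ha : ∀ i, 0 ≤ japR (x i) ^ (-(θ/2)) := fun i => Real.rpow_nonneg (japR_pos _).le _
  have ha' := ha a
  have hb' := ha b
  calc jap v ^ (1 - θ) * (‖x‖ ^ 2)⁻¹ * jap x ^ (-θ)
      ≤ (3 * (1 + |v j|) ^ (1 - θ)) *
        (|x j| ^ (-(θ/2)) * |x a| ^ (-1 + θ/4) * |x b| ^ (-1 + θ/4)) *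
        (japR (x a) ^ (-(θ/2)) * japR (x b) ^ (-(θ/2))) := by
        refine mul_le_mul (mul_le_mul e1 e2 (by positivity) (by positivity)) e3
          (Real.rpow_nonneg (jap_pos x).le _) (by positivity)
    _ = 3 * (((1 + |v j|) ^ (1 - θ) * |x j| ^ (-(θ/2))) * (kap θ (x a) * kap θ (x b))) := by
        simp only [kap]; ring
    _ ≤ _ := by
        rw [Fin.prod_univ_two]
        have := mul_nonneg (kap_nonneg θ (x a)) (kap_nonneg θ (x b))
        gcongr

lemma lintegral_prod_fin_two {g : ℝ → ENNReal} (hg : Measurable g) (c : Fin 2 → ℝ) :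
    ∫⁻ y : Fin 2 → ℝ, ∏ i, g (y i - c i) = (∫⁻ x, g x) ^ 2 := by
  have h := (volume_preserving_finTwoArrow ℝ).lintegral_comp_emb
    (MeasurableEquiv.finTwoArrow (α := ℝ)).measurableEmbedding
    (fun p : ℝ × ℝ => g (p.1 - c 0) * g (p.2 - c 1))
  simp only [MeasurableEquiv.finTwoArrow_apply] at h
  simp only [Fin.prod_univ_two]
  rw [h, Measure.volume_eq_prod, lintegral_prod_mul (f := fun x => g (x - c 0))
    (g := fun x => g (x - c 1)) (by fun_prop) (by fun_prop),
    lintegral_sub_right_eq_self, lintegral_sub_right_eq_self, sq]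

/-- Three-dimensional resonance integral, uniformly in the translations. -/
lemma exists_lintegral_resonance_three_le {q θ : ℝ} (hq : 1 < q) (h0 : 0 < θ) (h1 : θ < 1) :
    ∃ K : ENNReal, K < ⊤ ∧ ∀ (A : ℝ) (c : Rn 3),
      ∫⁻ v : Rn 3, ENNReal.ofReal (japR (A + 2 * ‖v‖ ^ 2) ^ (-q) *
        (jap v ^ (1 - θ) * (‖v - c‖ ^ 2)⁻¹ * jap (v - c) ^ (-θ))) ≤ K := by
  obtain ⟨K, hK, hKle⟩ := exists_lintegral_resonance_le hq
  set k : ENNReal := ∫⁻ x, ENNReal.ofReal (kap θ x)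
  have hk : k < ⊤ := lintegral_kap_lt_top h0
  refine ⟨3 * (3 * (K * k ^ 2)), ?_, fun A c => ?_⟩
  · exact ENNReal.mul_lt_top (by simp) (ENNReal.mul_lt_top (by simp)
      (ENNReal.mul_lt_top hK (ENNReal.pow_lt_top hk)))
  have hmeas : ∀ j : Fin 3, Measurable fun v : Fin 3 → ℝ =>
      ENNReal.ofReal (japR (A + 2 * ∑ i, v i ^ 2) ^ (-q) *
      ((1 + |v j| + |v j - c j| ^ (-(1/2) : ℝ)) *
        ∏ i : Fin 2, kap θ (v (j.succAbove i) - c (j.succAbove i)))) := by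
    intro j
    refine ENNReal.measurable_ofReal.comp ?_
    refine Measurable.mul (by fun_prop) (Measurable.mul (by fun_prop) ?_)
    refine Finset.measurable_prod _ fun i _ => ?_
    exact (measurable_kap θ).comp (by fun_prop)
  have hone : ∀ j : Fin 3, ∫⁻ v : Fin 3 → ℝ, ENNReal.ofReal (japR (A + 2 * ∑ i, v i ^ 2) ^ (-q) *
      ((1 + |v j| + |v j - c j| ^ (-(1/2) : ℝ)) *
        ∏ i : Fin 2, kap θ (v (j.succAbove i) - c (j.succAbove i)))) ≤ K * k ^ 2 := by
    intro j
    have h := (volume_preserving_piFinSuccAbove (fun _ : Fin 3 => ℝ) j).symm.lintegral_comp_emb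
      (MeasurableEquiv.piFinSuccAbove (fun _ : Fin 3 => ℝ) j).symm.measurableEmbedding
      (fun v : Fin 3 → ℝ => ENNReal.ofReal (japR (A + 2 * ∑ i, v i ^ 2) ^ (-q) *
      ((1 + |v j| + |v j - c j| ^ (-(1/2) : ℝ)) *
        ∏ i : Fin 2, kap θ (v (j.succAbove i) - c (j.succAbove i)))))
    rw [← h, Measure.volume_eq_prod, lintegral_prod_symm _ (by
      refine Measurable.aemeasurable ?_
      exact (hmeas j).comp
        (MeasurableEquiv.piFinSuccAbove (fun _ : Fin 3 => ℝ) j).symm.measurable)]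
    calc _ ≤ ∫⁻ y : Fin 2 → ℝ, K * ∏ i : Fin 2, ENNReal.ofReal (kap θ (y i - c (j.succAbove i))) := by
          refine lintegral_mono fun y => ?_
          simp only [MeasurableEquiv.piFinSuccAbove_symm_apply, Fin.insertNthEquiv_apply,
            Fin.insertNth_apply_same, Fin.insertNth_apply_succAbove, Fin.sum_univ_succAbove _ j]
          set P := ∏ i : Fin 2, kap θ (y i - c (j.succAbove i)) with hP
          have hP0 : 0 ≤ P := Finset.prod_nonneg fun _ _ => kap_nonneg _ _
          rw [← ENNReal.ofReal_prod_of_nonneg (fun _ _ => kap_nonneg _ _), ← hP]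
          calc _ = ∫⁻ x : ℝ, ENNReal.ofReal (japR ((A + 2 * ∑ i, y i ^ 2) + 2 * x ^ 2) ^ (-q) *
                (1 + |x| + |x - c j| ^ (-(1/2) : ℝ))) * ENNReal.ofReal P := by
                refine lintegral_congr fun x => ?_
                rw [← ENNReal.ofReal_mul (mul_nonneg (Real.rpow_nonneg (japR_pos _).le _)
                  (by positivity))]
                congr 1
                rw [show A + 2 * (x ^ 2 + ∑ i, y i ^ 2) = A + 2 * ∑ i, y i ^ 2 + 2 * x ^ 2 by ring]
                ring
            _ ≤ _ := by
                rw [lintegral_mul_const' _ _ (by simp)]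
                gcongr
                exact hKle _ _
      _ = _ := by
          rw [lintegral_const_mul' _ _ hK.ne,
            lintegral_prod_fin_two (g := fun x => ENNReal.ofReal (kap θ x)) (by fun_prop)
              (fun i => c (j.succAbove i))]
  rw [← (PiLp.volume_preserving_toLp (Fin 3)).lintegral_comp (by
    refine ENNReal.measurable_ofReal.comp ?_; fun_prop)]
  have hae : ∀ᵐ v : Fin 3 → ℝ, ∀ i, v i ≠ c i :=
    ae_all_iff.2 fun i => Measure.ae_eval_ne (μ := fun _ : Fin 3 => (volume : Measure ℝ)) i (c i)
  calc _ ≤ ∫⁻ v : Fin 3 → ℝ, 3 * ∑ j : Fin 3,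
        ENNReal.ofReal (japR (A + 2 * ∑ i, v i ^ 2) ^ (-q) *
      ((1 + |v j| + |v j - c j| ^ (-(1/2) : ℝ)) *
        ∏ i : Fin 2, kap θ (v (j.succAbove i) - c (j.succAbove i)))) := by
        refine lintegral_mono_ae ?_
        filter_upwards [hae] with v hv
        have hx : ∀ i, (WithLp.toLp 2 v - c : Rn 3) i ≠ 0 := fun i => by
          simpa [sub_eq_zero] using hv i
        have key := jap_weight_le_sum h0 h1 (WithLp.toLp 2 v) (WithLp.toLp 2 v - c) hx
        have hnv : ‖(WithLp.toLp 2 v : Rn 3)‖ ^ 2 = ∑ i, v i ^ 2 := by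
          simp [EuclideanSpace.norm_sq_eq]
        have hw : 0 ≤ japR (A + 2 * ∑ i, v i ^ 2) ^ (-q) := Real.rpow_nonneg (japR_pos _).le _
        rw [hnv, ← ENNReal.ofReal_sum_of_nonneg, show (3:ENNReal) = ENNReal.ofReal 3 by simp,
          ← ENNReal.ofReal_mul (by norm_num), ← Finset.mul_sum]
        · refine ENNReal.ofReal_le_ofReal ?_
          calc _ ≤ _ := mul_le_mul_of_nonneg_left key hw
            _ = _ := by simp only [PiLp.sub_apply]; ring
        · exact fun j _ => mul_nonneg hw (mul_nonneg (by positivity)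
            (Finset.prod_nonneg fun _ _ => kap_nonneg _ _))
    _ ≤ _ := by
        rw [lintegral_const_mul' _ _ (by simp), lintegral_finsetSum]
        · gcongr
          calc _ ≤ ∑ _j : Fin 3, K * k ^ 2 := Finset.sum_le_sum fun j _ => hone j
            _ = _ := by simp
        · exact fun j _ => hmeas j

lemma jap_add_le {n : ℕ} (x y : Rn n) : jap (x + y) ≤ jap x + ‖y‖ := by
  have hx := norm_le_jap x
  have h1 : jap x ^ 2 = 1 + ‖x‖ ^ 2 := Real.sq_sqrt (by positivity)
  rw [jap]
  refine Real.sqrt_le_iff.2 ⟨add_nonneg (jap_pos x).le (norm_nonneg y), ?_⟩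
  nlinarith [norm_add_le x y, norm_nonneg (x + y), norm_nonneg x, norm_nonneg y]

lemma jap_sq {n : ℕ} (x : Rn n) : jap x ^ 2 = 1 + ‖x‖ ^ 2 := Real.sq_sqrt (by positivity)

/-- Pointwise comparison of the resonance weight with translates of a single profile. -/
lemma jap_rpow_mul_inv_le {θ : ℝ} (h0 : 0 < θ) (h1 : θ < 1/2) (a b v : Rn 3)
    (hab : a = b + (-2 : ℝ) • v) (hv : v ≠ 0) :
    jap a ^ (1 - 2 * θ) * (‖b‖ ^ 2)⁻¹ ≤
      12 * (jap v ^ (1 - θ) * (‖b‖ ^ 2)⁻¹ * jap b ^ (-θ)) +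
      12 * (jap v ^ (1 - θ) * (‖v‖ ^ 2)⁻¹ * jap v ^ (-θ)) := by
  have hle : jap a ≤ jap b + 2 * jap v := by
    rw [hab]
    refine (jap_add_le _ _).trans ?_
    rw [norm_smul]
    simp only [norm_neg, Real.norm_ofNat]
    linarith [norm_le_jap v]
  have ha := jap_pos a
  have hb := jap_pos b
  have hvp := jap_pos v
  have hbi : 0 ≤ (‖b‖ ^ 2)⁻¹ := by positivity
  have three : ∀ x : ℝ, 0 < x → jap a ≤ 3 * x → jap a ^ (1 - 2 * θ) ≤ 3 * x ^ (1 - 2 * θ) := by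
    intro x hx hax
    calc jap a ^ (1 - 2 * θ) ≤ (3 * x) ^ (1 - 2 * θ) :=
          Real.rpow_le_rpow ha.le hax (by linarith)
      _ = 3 ^ (1 - 2 * θ) * x ^ (1 - 2 * θ) := Real.mul_rpow (by norm_num) hx.le
      _ ≤ 3 ^ (1 : ℝ) * x ^ (1 - 2 * θ) := by gcongr <;> linarith
      _ = _ := by rw [Real.rpow_one]
  have hR1 : 0 ≤ jap v ^ (1 - θ) * (‖b‖ ^ 2)⁻¹ * jap b ^ (-θ) := by positivity
  have hR2 : 0 ≤ jap v ^ (1 - θ) * (‖v‖ ^ 2)⁻¹ * jap v ^ (-θ) := by positivity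
  rcases le_or_gt (jap b) (jap v) with h | h
  · have e1 := three (jap v) hvp (by linarith)
    have e2 : jap v ^ (1 - 2 * θ) ≤ jap v ^ (1 - θ) * jap b ^ (-θ) := by
      rw [show 1 - 2 * θ = (1 - θ) + (-θ) by ring, Real.rpow_add hvp]
      exact mul_le_mul_of_nonneg_left (Real.rpow_le_rpow_of_nonpos hb h (by linarith))
        (by positivity)
    calc _ ≤ (3 * (jap v ^ (1 - θ) * jap b ^ (-θ))) * (‖b‖ ^ 2)⁻¹ :=
          mul_le_mul_of_nonneg_right (e1.trans (by linarith)) hbi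
      _ ≤ _ := by nlinarith
  · have e1 := three (jap b) hb (by linarith)
    have hb2 := jap_sq b
    rcases le_or_gt 1 ‖b‖ with hb1 | hb1
    · have e2 : (‖b‖ ^ 2)⁻¹ ≤ 2 * jap b ^ (-2 : ℝ) := by
        rw [Real.rpow_neg hb.le, Real.rpow_ofNat, ← div_eq_mul_inv, inv_le_comm₀ (by positivity)
          (by positivity), inv_div]
        nlinarith
      have e3 : jap v ^ (-1 - 2 * θ) ≤ jap v ^ (1 - θ) * (‖v‖ ^ 2)⁻¹ * jap v ^ (-θ) := by
        rw [show -1 - 2 * θ = (1 - θ) + (-2) + (-θ) by ring, Real.rpow_add hvp, Real.rpow_add hvp]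
        gcongr
        rw [Real.rpow_neg hvp.le, Real.rpow_ofNat]
        have : 0 < ‖v‖ := norm_pos_iff.2 hv
        gcongr
        exact norm_le_jap v
      have e4 : jap b ^ (-1 - 2 * θ) ≤ jap v ^ (-1 - 2 * θ) :=
        Real.rpow_le_rpow_of_nonpos hvp h.le (by linarith)
      have e5 : jap b ^ (1 - 2 * θ) * jap b ^ (-2 : ℝ) = jap b ^ (-1 - 2 * θ) := by
        rw [← Real.rpow_add hb]; congr 1; ring
      calc _ ≤ (3 * jap b ^ (1 - 2 * θ)) * (2 * jap b ^ (-2 : ℝ)) :=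
            mul_le_mul e1 e2 hbi (by positivity)
        _ = 6 * jap b ^ (-1 - 2 * θ) := by rw [← e5]; ring
        _ ≤ _ := by linarith
    · have hb3 : jap b ≤ 2 := by nlinarith [norm_nonneg b]
      have e2 : jap b ^ (1 - 2 * θ) ≤ 2 := by
        calc _ ≤ jap b ^ (1 : ℝ) :=
              Real.rpow_le_rpow_of_exponent_le (one_le_jap b) (by linarith)
          _ ≤ 2 := by rwa [Real.rpow_one]
      have e3 : 1 ≤ jap v ^ (1 - θ) := Real.one_le_rpow (one_le_jap v) (by linarith)
      have e4 : 1 / 2 ≤ jap b ^ (-θ) := by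
        calc (1:ℝ) / 2 = 2 ^ (-1 : ℝ) := by norm_num [Real.rpow_neg_one]
          _ ≤ jap b ^ (-1 : ℝ) := Real.rpow_le_rpow_of_nonpos hb hb3 (by norm_num)
          _ ≤ _ := Real.rpow_le_rpow_of_exponent_le (one_le_jap b) (by linarith)
      have e5 : 1 / 2 ≤ jap v ^ (1 - θ) * jap b ^ (-θ) := by nlinarith
      calc _ ≤ 6 * (‖b‖ ^ 2)⁻¹ := mul_le_mul_of_nonneg_right (by linarith) hbi
        _ ≤ 12 * (jap v ^ (1 - θ) * jap b ^ (-θ)) * (‖b‖ ^ 2)⁻¹ :=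
            mul_le_mul_of_nonneg_right (by linarith) hbi
        _ ≤ _ := by linarith

lemma japR_neg (x : ℝ) : japR (-x) = japR x := by simp [japR]

/-- The resonance kernel of the bilinear estimate is bounded. -/
lemma exists_lintegral_kernel_le {q θ : ℝ} (hq : 1 < q) (h0 : 0 < θ) (h1 : θ < 1/2) :
    ∃ K : ENNReal, K < ⊤ ∧ ∀ (η : Rn 3) (σ : ℝ),
      ∫⁻ ζ : Rn 3, ENNReal.ofReal (japR (σ - ‖η - ζ‖ ^ 2 - ‖ζ‖ ^ 2) ^ (-q) *
        (jap (η - ζ) ^ (1 - 2 * θ) * (‖ζ‖ ^ 2)⁻¹)) ≤ K := by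
  obtain ⟨K, hK, hKle⟩ := exists_lintegral_resonance_three_le hq h0 (h1.trans (by norm_num))
  refine ⟨12 * K + 12 * K, by finiteness, fun η σ => ?_⟩
  rw [← lintegral_add_right_eq_self _ ((1/2 : ℝ) • η)]
  set A := -σ + ‖η‖ ^ 2 / 2
  set c : Rn 3 := -((1/2 : ℝ) • η)
  have hJ : ∀ c : Rn 3, Measurable fun v : Rn 3 => ENNReal.ofReal (japR (A + 2 * ‖v‖ ^ 2) ^ (-q) *
        (jap v ^ (1 - θ) * (‖v - c‖ ^ 2)⁻¹ * jap (v - c) ^ (-θ))) := fun c => by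
    refine ENNReal.measurable_ofReal.comp ?_; fun_prop
  calc _ ≤ ∫⁻ v : Rn 3, (12 * ENNReal.ofReal (japR (A + 2 * ‖v‖ ^ 2) ^ (-q) *
        (jap v ^ (1 - θ) * (‖v - c‖ ^ 2)⁻¹ * jap (v - c) ^ (-θ))) +
        12 * ENNReal.ofReal (japR (A + 2 * ‖v‖ ^ 2) ^ (-q) *
        (jap v ^ (1 - θ) * (‖v - 0‖ ^ 2)⁻¹ * jap (v - 0) ^ (-θ)))) := by
        refine lintegral_mono_ae ?_
        filter_upwards [compl_mem_ae_iff.2 (measure_singleton (μ := volume) (0 : Rn 3))] with v hv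
        have e1 : v + (1/2 : ℝ) • η = v - c := by simp [c]
        have e2 : σ - ‖η - (v + (1/2 : ℝ) • η)‖ ^ 2 - ‖v + (1/2 : ℝ) • η‖ ^ 2 =
            -(A + 2 * ‖v‖ ^ 2) := by
          have e3 : η - (v + (1/2 : ℝ) • η) = (1/2 : ℝ) • η - v := by module
          rw [e3, norm_sub_sq_real, norm_add_sq_real, norm_smul, real_inner_comm]
          simp only [A, Real.norm_eq_abs, mul_pow, sq_abs]
          ring
        have key := jap_rpow_mul_inv_le h0 h1 (η - (v + (1/2 : ℝ) • η)) (v - c) v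
          (by rw [← e1]; module) hv
        have hw : 0 ≤ japR (A + 2 * ‖v‖ ^ 2) ^ (-q) := Real.rpow_nonneg (japR_pos _).le _
        have hp : ∀ b : Rn 3, 0 ≤ jap v ^ (1 - θ) * (‖b‖ ^ 2)⁻¹ * jap b ^ (-θ) := fun b => by
          have := jap_pos v; have := jap_pos b; positivity
        rw [e2, japR_neg, e1, sub_zero, show (12:ENNReal) = ENNReal.ofReal 12 by simp,
          ← ENNReal.ofReal_mul (by norm_num), ← ENNReal.ofReal_mul (by norm_num),
          ← ENNReal.ofReal_add (mul_nonneg (by norm_num) (mul_nonneg hw (hp _)))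
            (mul_nonneg (by norm_num) (mul_nonneg hw (hp _)))]
        refine ENNReal.ofReal_le_ofReal ?_
        rw [e1] at key
        calc _ ≤ _ := mul_le_mul_of_nonneg_left key hw
          _ = _ := by ring
    _ ≤ _ := by
        rw [lintegral_add_left ((hJ c).const_mul _), lintegral_const_mul _ (hJ c),
          lintegral_const_mul _ (hJ 0)]
        gcongr
        · exact hKle A c
        · exact hKle A 0

lemma japR_add_le (x y : ℝ) : japR (x + y) ≤ 2 * max (japR x) (japR y) := by
  have h1 : ∀ x, japR x ^ 2 = 1 + x ^ 2 := fun x => Real.sq_sqrt (by positivity)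
  have hx := one_le_japR x
  have hy := one_le_japR y
  have h0 := japR_pos (x + y)
  have := le_max_left (japR x) (japR y)
  have := le_max_right (japR x) (japR y)
  refine abs_le_of_sq_le_sq' ?_ (by positivity) |>.2
  rw [h1]
  nlinarith [h1 x, h1 y, sq_nonneg (x - y)]

/-- Convolution of two decaying brackets. -/
lemma exists_lintegral_japR_conv_le {q : ℝ} (hq : 1 < q) :
    ∃ K : ENNReal, K < ⊤ ∧ ∀ a b : ℝ,
      ∫⁻ t : ℝ, ENNReal.ofReal (japR (a - t) ^ (-q)) * ENNReal.ofReal (japR (t - b) ^ (-q)) ≤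
        K * ENNReal.ofReal (japR (a - b) ^ (-q)) := by
  set W : ENNReal := ∫⁻ x : ℝ, ENNReal.ofReal (japR x ^ (-q))
  have hW : W < ⊤ := lintegral_japR_rpow_neg_lt_top hq
  set k := ENNReal.ofReal ((2:ℝ) ^ q)
  refine ⟨k * (W + W), by finiteness, fun a b => ?_⟩
  set D := ENNReal.ofReal (japR (a - b) ^ (-q))
  calc _ ≤ ∫⁻ t : ℝ, (k * D) * (ENNReal.ofReal (japR (a - t) ^ (-q)) +
        ENNReal.ofReal (japR (t - b) ^ (-q))) := by
        refine lintegral_mono fun t => ?_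
        have key : ∀ x y : ℝ, japR (x + y) ≤ 2 * japR x → 
            ENNReal.ofReal (japR x ^ (-q)) ≤ k * ENNReal.ofReal (japR (x + y) ^ (-q)) := by
          intro x y h
          rw [← ENNReal.ofReal_mul (by positivity)]
          refine ENNReal.ofReal_le_ofReal ?_
          have := Real.rpow_le_rpow_of_nonpos (japR_pos _) h (show -q ≤ 0 by linarith)
          rw [Real.mul_rpow (by norm_num) (japR_pos _).le, Real.rpow_neg (by norm_num)] at this
          rwa [← inv_mul_le_iff₀ (by positivity)]
        have hs : a - b = (a - t) + (t - b) := by ring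
        rcases le_total (japR (a - t)) (japR (t - b)) with h | h
        · have h2 := japR_add_le (a - t) (t - b)
          rw [max_eq_right h, add_comm] at h2
          have := key _ _ h2
          rw [add_comm, ← hs] at this
          rw [mul_comm]
          gcongr
          exact le_self_add
        · have h2 := japR_add_le (a - t) (t - b)
          rw [max_eq_left h] at h2
          have := key _ _ h2
          rw [← hs] at this
          gcongr
          exact le_add_self
    _ = _ := by
        rw [lintegral_const_mul _ (by fun_prop), lintegral_add_left (by fun_prop),
          lintegral_sub_left_eq_self (fun x => ENNReal.ofReal (japR x ^ (-q))) a,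
          lintegral_sub_right_eq_self (fun x => ENNReal.ofReal (japR x ^ (-q))) b]
        ring

/-- The pointwise Fourier transform of an `L¹ ∩ L²` function represents its `L²` transform. -/
lemma fourier_toLp_ae_eq {H : ℝ → ℂ} (h1 : Integrable H) (h2 : MemLp H 2) :
    ((𝓕 (h2.toLp H) : Lp ℂ 2 (volume : Measure ℝ)) : ℝ → ℂ) =ᵐ[volume] 𝓕 H := by
  set Q : Lp ℂ 2 (volume : Measure ℝ) := 𝓕 (h2.toLp H)
  have hc : Continuous (𝓕 H) :=
    VectorFourier.fourierIntegral_continuous Real.continuous_fourierChar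
      (L := innerₗ ℝ) (by exact continuous_inner) h1
  refine ae_eq_of_integral_contDiff_smul_eq ((Lp.memLp Q).locallyIntegrable (by norm_num))
    hc.locallyIntegrable fun g hg hgs => ?_
  have hgs' : HasCompactSupport (fun x => (g x : ℂ)) :=
    hgs.comp_left (g := fun x : ℝ => (x : ℂ)) (by simp)
  set G : SchwartzMap ℝ ℂ := hgs'.toSchwartzMap (Complex.ofRealCLM.contDiff.comp hg)
  have hG : ∀ x, G x = (g x : ℂ) := fun x => rfl
  have e := congrArg (fun T => T G) (Lp.fourier_toTemperedDistribution_eq (h2.toLp H))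
  simp only [TemperedDistribution.fourier_apply, Lp.toTemperedDistribution_apply] at e
  have e1 : ∫ x, (𝓕 G) x • (h2.toLp H : ℝ → ℂ) x = ∫ x, (𝓕 G) x • H x :=
    integral_congr_ae (by filter_upwards [h2.coeFn_toLp] with x hx; rw [hx])
  have e2 : ∫ x, (𝓕 G) x • H x = ∫ x, G x • 𝓕 H x := by
    rw [SchwartzMap.fourier_coe]
    simpa using! (VectorFourier.integral_fourierIntegral_smul_eq_flip (L := innerₗ ℝ)
      Real.continuous_fourierChar (by exact continuous_inner) G.integrable h1)
  rw [e1, e2] at e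
  simp only [hG] at e
  simpa using e.symm

/-- Plancherel's inequality for the pointwise Fourier transform on the line. -/
lemma lintegral_enorm_fourier_sq_le {H : ℝ → ℂ} (h1 : Integrable H) :
    ∫⁻ t, ‖𝓕 H t‖ₑ ^ 2 ≤ ∫⁻ τ, ‖H τ‖ₑ ^ 2 := by
  by_cases hfin : ∫⁻ τ, ‖H τ‖ₑ ^ 2 = ⊤
  · rw [hfin]; exact le_top
  have heq : ∀ f : ℝ → ℂ, eLpNorm f 2 volume = (∫⁻ τ, ‖f τ‖ₑ ^ 2) ^ (1/2 : ℝ) := fun f => by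
    rw [eLpNorm_eq_lintegral_rpow_enorm_toReal (by norm_num) (by norm_num)]
    simp
  have h2 : MemLp H 2 := ⟨h1.aestronglyMeasurable, by
    rw [heq]; exact ENNReal.rpow_lt_top_of_nonneg (by norm_num) hfin⟩
  have hn : eLpNorm (𝓕 H) 2 volume = eLpNorm H 2 volume := by
    rw [← eLpNorm_congr_ae (fourier_toLp_ae_eq h1 h2), ← eLpNorm_congr_ae h2.coeFn_toLp]
    have := Lp.norm_fourier_eq (h2.toLp H)
    rwa [Lp.norm_def, Lp.norm_def, ENNReal.toReal_eq_toReal_iff' (Lp.eLpNorm_ne_top _)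
      (Lp.eLpNorm_ne_top _)] at this
  rw [heq, heq] at hn
  exact ((ENNReal.rpow_left_injective (by norm_num : (1/2:ℝ) ≠ 0)) hn).le

/-- Continuity together with the polynomial decay used for Fubini arguments. -/
def RapidDecay (Ψ : Rn 3 × ℝ → ℂ) : Prop :=
  Continuous Ψ ∧ ∃ C : ℝ, 0 ≤ C ∧ ∀ x, ‖Ψ x‖ ≤ C * ((1 + ‖x.1‖ ^ 2) ^ 3)⁻¹ * (1 + x.2 ^ 2)⁻¹

/-- The density of the squared weighted norm. -/
def wDensity (q : ℝ) (p : Rn 3 → ℝ) (Ψ : Rn 3 × ℝ → ℂ) (x : Rn 3 × ℝ) : ENNReal :=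
  ENNReal.ofReal (p x.1 ^ 2 * japR (x.2 - ‖x.1‖ ^ 2) ^ q) * ‖Ψ x‖ₑ ^ 2

/-- The weighted square integral `∬ p(ξ)² ⟨τ - |ξ|²⟩^q |Ψ|²`. -/
def wL2 (q : ℝ) (p : Rn 3 → ℝ) (Ψ : Rn 3 × ℝ → ℂ) : ENNReal :=
  ∫⁻ x, wDensity q p Ψ x

lemma integrable_inv_one_add_sq_pow_three :
    Integrable (fun x : Rn 3 => ((1 + ‖x‖ ^ 2) ^ 3)⁻¹) := by
  have h := integrable_rpow_neg_one_add_norm_sq (E := Rn 3) (μ := volume) (r := 6) (by simp; norm_num)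
  convert! h using 2 with x
  rw [show -(6:ℝ)/2 = -(3:ℕ) by norm_num, Real.rpow_neg (by positivity), Real.rpow_natCast]

lemma RapidDecay.integrable_snd {Ψ : Rn 3 × ℝ → ℂ} (h : RapidDecay Ψ) (ξ : Rn 3) :
    Integrable fun τ => Ψ (ξ, τ) := by
  obtain ⟨hc, C, hC, hb⟩ := h
  refine (integrable_inv_one_add_sq.const_mul (C * ((1 + ‖ξ‖ ^ 2) ^ 3)⁻¹)).mono'
    (by fun_prop) (ae_of_all _ fun τ => hb (ξ, τ))

/-- The partial Fourier transform is jointly measurable. -/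
lemma RapidDecay.measurable_fourier {Ψ : Rn 3 × ℝ → ℂ} (h : RapidDecay Ψ) :
    Measurable fun x : Rn 3 × ℝ => 𝓕 (fun τ => Ψ (x.1, τ)) x.2 := by
  have hc := h.1
  simp only [Real.fourier_real_eq]
  refine (StronglyMeasurable.integral_prod_right (f := fun (x : Rn 3 × ℝ) (v : ℝ) =>
    Real.fourierChar (-(v * x.2)) • Ψ (x.1, v)) ?_).measurable
  refine Continuous.stronglyMeasurable ?_
  have : Continuous fun x : (Rn 3 × ℝ) × ℝ => Real.fourierChar (-(x.2 * x.1.2)) :=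
    Real.continuous_fourierChar.comp (by fun_prop)
  exact this.smul (by fun_prop)

/-- The integrand of a space-time convolution, with a spatial weight on the first factor. -/
def convIntegrand (u : Rn 3 → ℝ) (f g : Rn 3 × ℝ → ℂ) (η : Rn 3) (y : Rn 3 × ℝ) (τ : ℝ) : ℂ :=
  (u (η - y.1) : ℂ) * f (η - y.1, τ - y.2) * g y

lemma integrable_convIntegrand {u : Rn 3 → ℝ} {f g : Rn 3 × ℝ → ℂ} (hu : Continuous u)
    (hu0 : ∀ x, 0 ≤ u x) (hu1 : ∀ x, u x ≤ (1 + ‖x‖ ^ 2) ^ 3) (hf : RapidDecay f)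
    (hg : RapidDecay g) (η : Rn 3) :
    Integrable (fun z : (Rn 3 × ℝ) × ℝ => convIntegrand u f g η z.1 z.2) := by
  obtain ⟨hfc, Cf, hCf, hfb⟩ := hf
  obtain ⟨hgc, Cg, hCg, hgb⟩ := hg
  set B := fun τ : ℝ => (1 + τ ^ 2)⁻¹
  have hB : Integrable B := integrable_inv_one_add_sq
  have hA := integrable_inv_one_add_sq_pow_three
  have hAB : Integrable (fun y : Rn 3 × ℝ => ((1 + ‖y.1‖ ^ 2) ^ 3)⁻¹ * B y.2) := hA.mul_prod hB
  have hABB : Integrable (fun z : (Rn 3 × ℝ) × ℝ =>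
      Cf * Cg * (((1 + ‖z.1.1‖ ^ 2) ^ 3)⁻¹ * B z.1.2 * B (z.2 - z.1.2))) := by
    refine Integrable.const_mul ?_ _
    have hBc : Continuous B := by
      refine Continuous.inv₀ (by fun_prop) fun x => by positivity
    have hcont : Continuous fun z : (Rn 3 × ℝ) × ℝ =>
        ((1 + ‖z.1.1‖ ^ 2) ^ 3)⁻¹ * B z.1.2 * B (z.2 - z.1.2) := by
      refine Continuous.mul (Continuous.mul (Continuous.inv₀ (by fun_prop) fun x => ?_)
        (by fun_prop)) (by fun_prop)
      positivity
    rw [Measure.volume_eq_prod, integrable_prod_iff hcont.aestronglyMeasurable]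
    refine ⟨ae_of_all _ fun y => by
      exact (hB.comp_sub_right y.2).const_mul (((1 + ‖y.1‖ ^ 2) ^ 3)⁻¹ * B y.2), ?_⟩
    have : ∀ y : Rn 3 × ℝ, ∫ τ, ‖((1 + ‖y.1‖ ^ 2) ^ 3)⁻¹ * B y.2 * B (τ - y.2)‖ =
        ((1 + ‖y.1‖ ^ 2) ^ 3)⁻¹ * B y.2 * ∫ τ, B τ := by
      intro y
      rw [← integral_sub_right_eq_self B y.2, ← integral_const_mul]
      refine integral_congr_ae (ae_of_all _ fun τ => ?_)
      simp only [B]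
      rw [Real.norm_of_nonneg (by positivity)]
    simp only [this]
    exact hAB.mul_const _
  refine hABB.mono' (Continuous.aestronglyMeasurable (by unfold convIntegrand; fun_prop))
    (ae_of_all _ fun z => ?_)
  rw [convIntegrand, norm_mul, norm_mul, Complex.norm_of_nonneg (hu0 _)]
  calc _ ≤ (1 + ‖η - z.1.1‖ ^ 2) ^ 3 *
        (Cf * ((1 + ‖η - z.1.1‖ ^ 2) ^ 3)⁻¹ * (1 + (z.2 - z.1.2) ^ 2)⁻¹) *
        (Cg * ((1 + ‖z.1.1‖ ^ 2) ^ 3)⁻¹ * (1 + z.1.2 ^ 2)⁻¹) := by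
        gcongr
        · exact hu1 _
        · exact hfb (η - z.1.1, z.2 - z.1.2)
        · exact hgb z.1
    _ = _ := by
        have : (1 + ‖η - z.1.1‖ ^ 2) ^ 3 ≠ 0 := by positivity
        simp only [B]
        field_simp

lemma lintegral_enorm_eq_of_nonneg {α : Type*} [MeasurableSpace α] {μ : Measure α} {g : α → ℂ}
    (hg : Integrable g μ) (h : ∀ x, 0 ≤ (g x).re ∧ (g x).im = 0) :
    ∫⁻ x, ‖g x‖ₑ ∂μ = ‖∫ x, g x ∂μ‖ₑ := by
  have e : ∀ x, g x = ((g x).re : ℂ) := fun x => Complex.ext rfl (by simp [(h x).2])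
  have e2 : ∫ x, g x ∂μ = ((∫ x, (g x).re ∂μ : ℝ) : ℂ) := by
    rw [← integral_complex_ofReal]; exact integral_congr_ae (ae_of_all _ e)
  have e3 : ∀ x, ‖g x‖ₑ = ENNReal.ofReal (g x).re := fun x => by
    rw [e x, ← ofReal_norm, Complex.norm_of_nonneg (h x).1]; simp
  rw [e2, ← ofReal_norm, Complex.norm_of_nonneg (integral_nonneg fun x => (h x).1),
    ofReal_integral_eq_lintegral_ofReal (f := fun x => (g x).re) hg.re
      (ae_of_all _ fun x => (h x).1)]
  simp only [e3]

/-- For each output frequency, Plancherel in time. -/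
lemma lintegral_sq_conv_le {u : Rn 3 → ℝ} {f g : Rn 3 × ℝ → ℂ} (hu : Continuous u)
    (hu0 : ∀ x, 0 ≤ u x) (hu1 : ∀ x, u x ≤ (1 + ‖x‖ ^ 2) ^ 3) (hf : RapidDecay f)
    (hg : RapidDecay g)
    (hfn : ∀ ξ t, 0 ≤ (𝓕 (fun τ => f (ξ, τ)) t).re ∧ (𝓕 (fun τ => f (ξ, τ)) t).im = 0)
    (hgn : ∀ ξ t, 0 ≤ (𝓕 (fun τ => g (ξ, τ)) t).re ∧ (𝓕 (fun τ => g (ξ, τ)) t).im = 0)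
    (η : Rn 3) :
    ∫⁻ t, (∫⁻ ζ, ENNReal.ofReal (u (η - ζ)) * ‖𝓕 (fun τ => f (η - ζ, τ)) t‖ₑ *
        ‖𝓕 (fun τ => g (ζ, τ)) t‖ₑ) ^ 2 ≤
      ∫⁻ τ, (∫⁻ y, ‖convIntegrand u f g η y τ‖ₑ) ^ 2 := by
  have hint := integrable_convIntegrand hu hu0 hu1 hf hg η
  set H : ℝ → ℂ := fun τ => ∫ y, convIntegrand u f g η y τ with hH
  have hHint : Integrable H := hint.integral_prod_right
  have hchar : ∀ t : ℝ, Continuous fun τ : ℝ => Real.fourierChar (-(τ * t)) := fun t =>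
    Real.continuous_fourierChar.comp (by fun_prop)
  have hint2 : ∀ t : ℝ, Integrable (fun z : (Rn 3 × ℝ) × ℝ =>
      Real.fourierChar (-(z.2 * t)) • convIntegrand u f g η z.1 z.2) := fun t => by
    refine hint.mono (((hchar t).comp continuous_snd).aestronglyMeasurable.smul
      hint.aestronglyMeasurable) (ae_of_all _ fun z => ?_)
    simp [Circle.norm_smul]
  have inner : ∀ t : ℝ, ∀ y : Rn 3 × ℝ,
      ∫ τ, Real.fourierChar (-(τ * t)) • convIntegrand u f g η y τ =
        (u (η - y.1) : ℂ) * 𝓕 (fun τ => f (η - y.1, τ)) t *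
          (Real.fourierChar (-(y.2 * t)) • g y) := by
    intro t y
    rw [← integral_add_right_eq_self _ y.2, Real.fourier_real_eq, ← integral_const_mul,
      ← integral_mul_const]
    refine integral_congr_ae (ae_of_all _ fun τ => ?_)
    simp only [convIntegrand, add_sub_cancel_right, Circle.smul_def, smul_eq_mul]
    rw [show -((τ + y.2) * t) = -(τ * t) + -(y.2 * t) by ring, AddChar.map_add_eq_mul,
      Circle.coe_mul]
    ring
  have hint3 : ∀ t : ℝ, Integrable fun y : Rn 3 × ℝ =>
      (u (η - y.1) : ℂ) * 𝓕 (fun τ => f (η - y.1, τ)) t *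
          (Real.fourierChar (-(y.2 * t)) • g y) := fun t => by
    have := (hint2 t).integral_prod_left
    simpa only [inner t] using this
  have inner2 : ∀ t : ℝ, ∀ ζ : Rn 3, ∫ σ, (u (η - ζ) : ℂ) * 𝓕 (fun τ => f (η - ζ, τ)) t *
          (Real.fourierChar (-(σ * t)) • g (ζ, σ)) =
        (u (η - ζ) : ℂ) * 𝓕 (fun τ => f (η - ζ, τ)) t * 𝓕 (fun τ => g (ζ, τ)) t := by
    intro t ζ
    rw [integral_const_mul, Real.fourier_real_eq (fun τ => g (ζ, τ))]
  have hint4 : ∀ t : ℝ, Integrable fun ζ : Rn 3 =>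
      (u (η - ζ) : ℂ) * 𝓕 (fun τ => f (η - ζ, τ)) t * 𝓕 (fun τ => g (ζ, τ)) t := fun t => by
    have := (hint3 t).integral_prod_left
    simpa only [inner2 t] using this
  have hFH : ∀ t : ℝ, 𝓕 H t =
      ∫ ζ, (u (η - ζ) : ℂ) * 𝓕 (fun τ => f (η - ζ, τ)) t * 𝓕 (fun τ => g (ζ, τ)) t := by
    intro t
    rw [Real.fourier_real_eq]
    simp only [hH, Circle.smul_def, ← integral_smul]
    simp only [← Circle.smul_def]
    rw [integral_integral_swap (f := fun τ y => Real.fourierChar (-(τ * t)) •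
      convIntegrand u f g η y τ) (hint2 t).swap]
    simp only [inner t]
    rw [Measure.volume_eq_prod, integral_prod _ (hint3 t)]
    simp only [inner2 t]
  have hF : ∀ t : ℝ, ∫⁻ ζ, ENNReal.ofReal (u (η - ζ)) * ‖𝓕 (fun τ => f (η - ζ, τ)) t‖ₑ *
        ‖𝓕 (fun τ => g (ζ, τ)) t‖ₑ = ‖𝓕 H t‖ₑ := by
    intro t
    rw [hFH, ← lintegral_enorm_eq_of_nonneg (hint4 t)]
    · refine lintegral_congr fun ζ => ?_
      rw [enorm_mul, enorm_mul, ← ofReal_norm (u (η - ζ) : ℂ),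
        Complex.norm_of_nonneg (hu0 _)]
    · intro ζ
      obtain ⟨a1, a2⟩ := hfn (η - ζ) t
      obtain ⟨b1, b2⟩ := hgn ζ t
      simp only [Complex.mul_re, Complex.mul_im, Complex.ofReal_re, Complex.ofReal_im, a2, b2,
        mul_zero, zero_mul, sub_zero, add_zero, and_true]
      exact mul_nonneg (mul_nonneg (hu0 _) a1) b1
  simp only [hF]
  refine (lintegral_enorm_fourier_sq_le hHint).trans (lintegral_mono fun τ => ?_)
  gcongr
  exact enorm_integral_le_lintegral_enorm _

/-- The Cauchy–Schwarz inequality for lower Lebesgue integrals. -/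
lemma lintegral_sq_le_of_sq_le_mul {α : Type*} [MeasurableSpace α] {μ : Measure α}
    {F A B : α → ENNReal} (hA : AEMeasurable A μ) (hB : AEMeasurable B μ)
    (h : ∀ᵐ x ∂μ, F x ^ 2 ≤ A x * B x) :
    (∫⁻ x, F x ∂μ) ^ 2 ≤ (∫⁻ x, A x ∂μ) * ∫⁻ x, B x ∂μ := by
  have hsq : ∀ a : ENNReal, (a ^ (1/2 : ℝ)) ^ (2:ℝ) = a := fun a => by
    rw [← ENNReal.rpow_mul]; norm_num
  have hsq' : ∀ a : ENNReal, (a ^ (1/2 : ℝ)) ^ (2:ℕ) = a := fun a => by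
    rw [← ENNReal.rpow_natCast, ← ENNReal.rpow_mul]; norm_num
  have h1 : ∫⁻ x, F x ∂μ ≤ ∫⁻ x, ((fun x => A x ^ (1/2 : ℝ)) * fun x => B x ^ (1/2 : ℝ)) x ∂μ := by
    refine lintegral_mono_ae ?_
    filter_upwards [h] with x hx
    rw [Pi.mul_apply, ← ENNReal.mul_rpow_of_nonneg _ _ (by norm_num)]
    calc F x = (F x ^ (2:ℕ)) ^ (1/2 : ℝ) := by
          rw [← ENNReal.rpow_natCast, ← ENNReal.rpow_mul]; norm_num
      _ ≤ _ := ENNReal.rpow_le_rpow hx (by norm_num)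
  have h2 := h1.trans (ENNReal.lintegral_mul_le_Lp_mul_Lq μ Real.HolderConjugate.two_two
    (hA.pow_const _) (hB.pow_const _))
  simp only [hsq] at h2
  calc _ ≤ _ := pow_le_pow_left' h2 2
    _ = _ := by rw [mul_pow, hsq', hsq']

lemma measurable_wDensity {q : ℝ} {p : Rn 3 → ℝ} (hp : Continuous p) {Ψ : Rn 3 × ℝ → ℂ}
    (hΨ : Continuous Ψ) : Measurable (wDensity q p Ψ) := by
  unfold wDensity; fun_prop

lemma lintegral_conv_eq {f g : Rn 3 × ℝ → ENNReal} (hf : Measurable f) (hg : Measurable g) :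
    ∫⁻ x, ∫⁻ y, f (x - y) * g y = (∫⁻ x, f x) * ∫⁻ x, g x := by
  have : (volume : Measure (Rn 3 × ℝ)).IsAddHaarMeasure :=
    inferInstanceAs ((volume : Measure (Rn 3)).prod (volume : Measure ℝ)).IsAddHaarMeasure
  rw [lintegral_lintegral_swap (by fun_prop)]
  have : ∀ y, ∫⁻ x, f (x - y) * g y = (∫⁻ x, f x) * g y := fun y => by
    rw [lintegral_mul_const _ (by fun_prop), lintegral_sub_right_eq_self]
  simp only [this]
  rw [lintegral_const_mul _ hg]

/-- The weighted bilinear space-time estimate. -/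
lemma exists_bilinear_le {q θ : ℝ} (hq : 1 < q) (h0 : 0 < θ) (h1 : θ < 1/2) :
    ∃ K : ENNReal, K < ⊤ ∧ ∀ (p : Rn 3 → ℝ), Continuous p → (∀ x, 0 ≤ p x ∧ p x ≤ jap x) →
      ∀ f g : Rn 3 × ℝ → ℂ, RapidDecay f → RapidDecay g →
      (∀ ξ t, 0 ≤ (𝓕 (fun τ => f (ξ, τ)) t).re ∧ (𝓕 (fun τ => f (ξ, τ)) t).im = 0) →
      (∀ ξ t, 0 ≤ (𝓕 (fun τ => g (ξ, τ)) t).re ∧ (𝓕 (fun τ => g (ξ, τ)) t).im = 0) →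
      ∫⁻ η, ∫⁻ t, (∫⁻ ζ, ENNReal.ofReal (jap (η - ζ) ^ (1/2 - θ) * p (η - ζ)) *
        ‖𝓕 (fun τ => f (η - ζ, τ)) t‖ₑ * ‖𝓕 (fun τ => g (ζ, τ)) t‖ₑ) ^ 2 ≤
      K * (wL2 q p f * wL2 q (fun ξ => ‖ξ‖) g) := by
  obtain ⟨K₁, hK₁, hker⟩ := exists_lintegral_kernel_le hq h0 h1
  obtain ⟨K₂, hK₂, hconv⟩ := exists_lintegral_japR_conv_le hq
  refine ⟨K₂ * K₁, by finiteness, fun p hp hpb f g hf hg hfn hgn => ?_⟩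
  set u : Rn 3 → ℝ := fun x => jap x ^ (1/2 - θ) * p x with hudef
  have hu : Continuous u := by
    refine Continuous.mul (continuous_jap.rpow_const fun x => Or.inl (jap_pos x).ne') hp
  have hu0 : ∀ x, 0 ≤ u x := fun x =>
    mul_nonneg (Real.rpow_nonneg (jap_pos x).le _) (hpb x).1
  have hu1 : ∀ x, u x ≤ (1 + ‖x‖ ^ 2) ^ 3 := fun x => by
    rw [← jap_sq]
    have h := one_le_jap x
    calc u x ≤ jap x ^ (1 : ℝ) * jap x := by
          refine mul_le_mul (Real.rpow_le_rpow_of_exponent_le h (by linarith)) (hpb x).2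
            (hpb x).1 (Real.rpow_nonneg (jap_pos x).le _)
      _ = jap x ^ 2 := by rw [Real.rpow_one, sq]
      _ ≤ _ := le_self_pow₀ (one_le_pow₀ h) (by norm_num)
  have hMf : Measurable (wDensity q p f) := measurable_wDensity hp hf.1
  have hMg : Measurable (wDensity q (fun ξ => ‖ξ‖) g) := measurable_wDensity continuous_norm hg.1
  have hpoint : ∀ η τ, (∫⁻ y, ‖convIntegrand u f g η y τ‖ₑ) ^ 2 ≤
      K₂ * K₁ * ∫⁻ y, wDensity q p f ((η, τ) - y) * wDensity q (fun ξ => ‖ξ‖) g y := by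
    intro η τ
    set A := fun y : Rn 3 × ℝ => ENNReal.ofReal (jap (η - y.1) ^ (1 - 2 * θ) * (‖y.1‖ ^ 2)⁻¹) *
        (ENNReal.ofReal (japR ((τ - ‖η - y.1‖ ^ 2) - y.2) ^ (-q)) *
          ENNReal.ofReal (japR (y.2 - ‖y.1‖ ^ 2) ^ (-q)))
    have hA : Measurable A := by fun_prop
    have hae : ∀ᵐ y : Rn 3 × ℝ, y.1 ≠ 0 := by
      rw [Measure.volume_eq_prod]
      exact Measure.quasiMeasurePreserving_fst.ae
        (compl_mem_ae_iff.2 (measure_singleton (μ := volume) (0 : Rn 3)))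
    refine (lintegral_sq_le_of_sq_le_mul (A := A) (B := fun y => wDensity q p f ((η, τ) - y) * wDensity q (fun ξ => ‖ξ‖) g y)
      hA.aemeasurable 
      ((hMf.comp (measurable_const.sub measurable_id)).mul hMg).aemeasurable ?_).trans ?_
    · filter_upwards [hae] with y hy
      obtain ⟨b, σ⟩ := y
      simp only at hy
      have hb : 0 < ‖b‖ := norm_pos_iff.2 hy
      set a := η - b
      simp only [A, wDensity, convIntegrand, Prod.mk_sub_mk]
      rw [enorm_mul, enorm_mul, ← ofReal_norm (u (η - b) : ℂ), Complex.norm_of_nonneg (hu0 _)]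
      have hj := jap_pos a
      have w1 := japR_pos (τ - σ - ‖a‖ ^ 2)
      have w2 := japR_pos (σ - ‖b‖ ^ 2)
      have hpa := (hpb a).1
      have hexp : u a ^ 2 = (jap a ^ (1 - 2 * θ) * (‖b‖ ^ 2)⁻¹) *
          (japR (τ - σ - ‖a‖ ^ 2) ^ (-q) * japR (σ - ‖b‖ ^ 2) ^ (-q)) *
          ((p a ^ 2 * japR (τ - σ - ‖a‖ ^ 2) ^ q) * (‖b‖ ^ 2 * japR (σ - ‖b‖ ^ 2) ^ q)) := by
        rw [Real.rpow_neg w1.le, Real.rpow_neg w2.le, hudef]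
        have e : (jap a ^ (1/2 - θ)) ^ 2 = jap a ^ (1 - 2 * θ) := by
          rw [← Real.rpow_natCast, ← Real.rpow_mul hj.le]; congr 1; push_cast; ring
        simp only [mul_pow, e]
        have := Real.rpow_pos_of_pos w1 q
        have := Real.rpow_pos_of_pos w2 q
        field_simp
      rw [show τ - ‖a‖ ^ 2 - σ = τ - σ - ‖a‖ ^ 2 by ring, mul_pow, mul_pow,
        ← ENNReal.ofReal_pow (hu0 _), hexp, ENNReal.ofReal_mul (by positivity),
        ENNReal.ofReal_mul (p := jap a ^ (1 - 2 * θ) * (‖b‖ ^ 2)⁻¹) (by positivity),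
        ENNReal.ofReal_mul (p := p a ^ 2 * japR (τ - σ - ‖a‖ ^ 2) ^ q) (by positivity),
        ENNReal.ofReal_mul (p := japR (τ - σ - ‖a‖ ^ 2) ^ (-q)) (by positivity)]
      refine le_of_eq ?_
      ring
    · refine mul_le_mul' ?_ le_rfl
      rw [Measure.volume_eq_prod, lintegral_prod _ hA.aemeasurable]
      calc _ ≤ ∫⁻ b : Rn 3, K₂ * ENNReal.ofReal (japR (τ - ‖η - b‖ ^ 2 - ‖b‖ ^ 2) ^ (-q) *
            (jap (η - b) ^ (1 - 2 * θ) * (‖b‖ ^ 2)⁻¹)) := by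
            refine lintegral_mono fun b => ?_
            simp only [A]
            rw [lintegral_const_mul _ (by fun_prop),
              ENNReal.ofReal_mul (Real.rpow_nonneg (japR_pos _).le _), mul_comm, ← mul_assoc]
            gcongr
            exact hconv _ _
        _ ≤ _ := by
            rw [lintegral_const_mul' _ _ hK₂.ne]
            gcongr
            exact hker η τ
  calc _ ≤ ∫⁻ η, ∫⁻ τ, K₂ * K₁ * ∫⁻ y, wDensity q p f ((η, τ) - y) * wDensity q (fun ξ => ‖ξ‖) g y :=
        lintegral_mono fun η => (lintegral_sq_conv_le hu hu0 hu1 hf hg hfn hgn η).trans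
          (lintegral_mono fun τ => hpoint η τ)
    _ = ∫⁻ x : Rn 3 × ℝ, K₂ * K₁ * ∫⁻ y, wDensity q p f (x - y) * wDensity q (fun ξ => ‖ξ‖) g y := by
        rw [Measure.volume_eq_prod, lintegral_prod _ (by
          refine (Measurable.const_mul ?_ _).aemeasurable
          refine Measurable.lintegral_prod_right' (f := fun z : (Rn 3 × ℝ) × (Rn 3 × ℝ) =>
            wDensity q p f (z.1 - z.2) * wDensity q (fun ξ => ‖ξ‖) g z.2)
            ((hMf.comp (measurable_fst.sub measurable_snd)).mul (hMg.comp measurable_snd)))]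
    _ = _ := by
        rw [lintegral_const_mul' _ _ (by finiteness), lintegral_conv_eq hMf hMg]
        rfl

/-- The multiplier is not much smaller than a square root of the inverse frequency. -/
lemma IsAdmissibleMultiplier.inv_pow_three_le {s : ℝ} {m₁ : Rn 3 → ℝ} (hs : 5/6 < s)
    (h : IsAdmissibleMultiplier 3 s m₁) {z : Rn 3} (hz : 1/3 ≤ ‖z‖) :
    (m₁ z ^ 3)⁻¹ ≤ 4 * ‖z‖ ^ (1/2 : ℝ) := by
  obtain ⟨-, hpos, -, hmono, -, hbig⟩ := h
  have hz0 : 0 < ‖z‖ := by linarith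
  have hval : ∀ y : Rn 3, 2 ≤ ‖y‖ → (m₁ y ^ 3)⁻¹ ≤ ‖y‖ ^ (1/2 : ℝ) := by
    intro y hy
    have hy0 : 0 < ‖y‖ := by linarith
    rw [hbig y hy, ← Real.rpow_natCast, ← Real.rpow_mul hy0.le, ← Real.rpow_neg hy0.le]
    exact Real.rpow_le_rpow_of_exponent_le (by linarith) (by push_cast; linarith)
  rcases le_or_gt 2 ‖z‖ with h2 | h2
  · have := hval z h2
    have := Real.rpow_nonneg hz0.le (1/2 : ℝ)
    linarith
  · set y : Rn 3 := EuclideanSpace.single 0 2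
    have hy : ‖y‖ = 2 := by simp [y]
    have h3 := hval y hy.ge
    have h4 : (m₁ z ^ 3)⁻¹ ≤ (m₁ y ^ 3)⁻¹ := by
      have := (hpos y).1
      have := hmono z y (by rw [hy]; exact h2.le)
      gcongr
    refine h4.trans (h3.trans ?_)
    rw [hy, ← Real.sqrt_eq_rpow, ← Real.sqrt_eq_rpow,
      show (4:ℝ) = √16 by rw [show (16:ℝ) = 4 ^ 2 by norm_num]; simp,
      ← Real.sqrt_mul (by norm_num)]
    exact Real.sqrt_le_sqrt (by linarith)

/-- The weight carried by the dominant high-frequency factor. -/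
lemma sqrt_ratio_le {ε N n j j₁ : ℝ} (hε : 0 < ε) (hε1 : ε < 1/2) (hN : 1 ≤ N)
    (hn : N / 3 ≤ n) (hj : 0 < j) (hjn : j ≤ 4 * n) (hj1 : 0 < j₁) (hjj : j₁ ≤ 3 * j) :
    n ^ (1/2 : ℝ) * N ^ (-(1/2) : ℝ) ≤
      36 * (N ^ (-1 + ε) * (j₁ ^ (1/2 - ε/2) * j₁⁻¹) * (j ^ (1/2 - ε/2) * n)) := by
  have hN0 : 0 < N := by linarith
  have hn0 : 0 < n := by linarith
  have e1 : (1/3) * j ^ (-(1/2) - ε/2) ≤ j₁ ^ (1/2 - ε/2) * j₁⁻¹ := by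
    have : j₁ ^ (1/2 - ε/2) * j₁⁻¹ = j₁ ^ (-(1/2) - ε/2) := by
      rw [← Real.rpow_neg_one, ← Real.rpow_add hj1]; congr 1; ring
    rw [this]
    calc _ ≤ 3 ^ (-(1/2) - ε/2) * j ^ (-(1/2) - ε/2) := by
          gcongr
          calc (1:ℝ)/3 = 3 ^ (-1 : ℝ) := by rw [Real.rpow_neg_one]; norm_num
            _ ≤ _ := Real.rpow_le_rpow_of_exponent_le (by norm_num) (by linarith)
      _ = (3 * j) ^ (-(1/2) - ε/2) := (Real.mul_rpow (by norm_num) hj.le).symm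
      _ ≤ _ := Real.rpow_le_rpow_of_nonpos hj1 hjj (by linarith)
  have e2 : (1/4) * n ^ (-ε) ≤ j ^ (-ε) := by
    calc _ ≤ 4 ^ (-ε) * n ^ (-ε) := by
          gcongr
          calc (1:ℝ)/4 = 4 ^ (-1 : ℝ) := by rw [Real.rpow_neg_one]; norm_num
            _ ≤ _ := Real.rpow_le_rpow_of_exponent_le (by norm_num) (by linarith)
      _ = (4 * n) ^ (-ε) := (Real.mul_rpow (by norm_num) hn0.le).symm
      _ ≤ _ := Real.rpow_le_rpow_of_nonpos hj hjn (by linarith)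
  have e3 : (1/3) * N ^ (1/2 - ε) ≤ n ^ (1/2 - ε) := by
    calc _ ≤ (1/3) ^ (1/2 - ε) * N ^ (1/2 - ε) := by
          gcongr
          calc (1:ℝ)/3 = (1/3) ^ (1 : ℝ) := by rw [Real.rpow_one]
            _ ≤ _ := Real.rpow_le_rpow_of_exponent_ge (by norm_num) (by norm_num) (by linarith)
      _ = (1/3 * N) ^ (1/2 - ε) := (Real.mul_rpow (by norm_num) hN0.le).symm
      _ ≤ _ := Real.rpow_le_rpow (by positivity) (by linarith) (by linarith)
  have e4 : j ^ (-(1/2) - ε/2) * j ^ (1/2 - ε/2) = j ^ (-ε) := by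
    rw [← Real.rpow_add hj]; congr 1; ring
  have e5 : n ^ (-ε) * n = n ^ (1/2 : ℝ) * n ^ (1/2 - ε) := by
    rw [← Real.rpow_add hn0, ← Real.rpow_add_one hn0.ne']; congr 1; ring
  have e6 : N ^ (-(1/2) : ℝ) = N ^ (-1 + ε) * N ^ (1/2 - ε) := by
    rw [← Real.rpow_add hN0]; congr 1; ring
  calc n ^ (1/2 : ℝ) * N ^ (-(1/2) : ℝ)
      = 3 * (N ^ (-1 + ε) * (n ^ (1/2 : ℝ) * ((1/3) * N ^ (1/2 - ε)))) := by rw [e6]; ring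
    _ ≤ 3 * (N ^ (-1 + ε) * (n ^ (1/2 : ℝ) * n ^ (1/2 - ε))) := by gcongr
    _ = 12 * (N ^ (-1 + ε) * (((1/4) * n ^ (-ε)) * n)) := by rw [← e5]; ring
    _ ≤ 12 * (N ^ (-1 + ε) * (j ^ (-ε) * n)) := by gcongr
    _ = 36 * (N ^ (-1 + ε) * ((1/3) * j ^ (-(1/2) - ε/2)) * (j ^ (1/2 - ε/2) * n)) := by
        rw [← e4]; ring
    _ ≤ _ := by gcongr

/-- Pointwise bound for the commutator symbol by the weights of the bilinear estimate. -/
lemma abs_symbol_le {s : ℝ} {m₁ : Rn 3 → ℝ} (hs : 5/6 < s) (h : IsAdmissibleMultiplier 3 s m₁)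
    {ε N : ℝ} (hε : 0 < ε) (hε1 : ε < 1/2) (hN : 1 ≤ N) (x y z : Rn 3) :
    |1 - mN m₁ N (x + y + z) / (mN m₁ N x * mN m₁ N y * mN m₁ N z)| ≤
      144 * (N ^ (-1 + ε) * (jap (-x - y - z) ^ (1/2 - ε/2) * (jap (-x - y - z))⁻¹) *
        (jap x ^ (1/2 - ε/2) * ‖x‖ + jap y ^ (1/2 - ε/2) * ‖y‖ +
          jap z ^ (1/2 - ε/2) * ‖z‖)) := by
  have hN0 : 0 < N := by linarith
  have hj := fun v : Rn 3 => jap_pos v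
  have hnorm : ∀ v : Rn 3, ‖N⁻¹ • v‖ = ‖v‖ / N := fun v => by
    rw [norm_smul, Real.norm_of_nonneg (by positivity)]; ring
  have hmpos : ∀ v, 0 < mN m₁ N v := fun v => (h.2.1 _).1
  have hmle : ∀ v, mN m₁ N v ≤ 1 := fun v => (h.2.1 _).2
  have hmmono : ∀ v w, ‖v‖ ≤ ‖w‖ → mN m₁ N w ≤ mN m₁ N v := fun v w hvw =>
    h.2.2.2.1 _ _ (by rw [hnorm, hnorm]; gcongr)
  have hm1 : ∀ v, ‖v‖ ≤ N → mN m₁ N v = 1 := fun v hv =>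
    h.2.2.2.2.1 _ (by rw [hnorm]; exact (div_le_one hN0).2 hv)
  have hsum : ‖x + y + z‖ ≤ ‖x‖ + ‖y‖ + ‖z‖ := norm_add₃_le
  have hβ : ∀ v : Rn 3, 0 ≤ jap v ^ (1/2 - ε/2) * ‖v‖ := fun v =>
    mul_nonneg (Real.rpow_nonneg (hj v).le _) (norm_nonneg v)
  have hneg : jap (-x - y - z) = jap (x + y + z) := by
    rw [jap, jap, show -x - y - z = -(x + y + z) by abel, norm_neg]
  rw [hneg]
  have hα : 0 ≤ N ^ (-1 + ε) * (jap (x + y + z) ^ (1/2 - ε/2) * (jap (x + y + z))⁻¹) :=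
    mul_nonneg (by positivity) (mul_nonneg (Real.rpow_nonneg (hj _).le _) (inv_nonneg.2 (hj _).le))
  have key : ∀ w : Rn 3, ‖x‖ ≤ ‖w‖ → ‖y‖ ≤ ‖w‖ → ‖z‖ ≤ ‖w‖ →
      |1 - mN m₁ N (x + y + z) / (mN m₁ N x * mN m₁ N y * mN m₁ N z)| ≤
      144 * (N ^ (-1 + ε) * (jap (x + y + z) ^ (1/2 - ε/2) * (jap (x + y + z))⁻¹) *
        (jap w ^ (1/2 - ε/2) * ‖w‖)) := by
    intro w hx hy hz
    rcases le_or_gt ‖w‖ (N / 3) with hw | hw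
    · rw [hm1 x (by linarith), hm1 y (by linarith), hm1 z (by linarith),
        hm1 (x + y + z) (by linarith)]
      simp only [mul_one, div_one, sub_self, abs_zero]
      exact mul_nonneg (by norm_num) (mul_nonneg hα (hβ w))
    · have hw0 : 0 < ‖w‖ := by linarith
      have hmw := hmpos w
      have hprod : mN m₁ N w ^ 3 ≤ mN m₁ N x * mN m₁ N y * mN m₁ N z := by
        have := hmmono x w hx
        have := hmmono y w hy
        have := hmmono z w hz
        have := hmpos x; have := hmpos y; have := hmpos z
        calc mN m₁ N w ^ 3 = mN m₁ N w * mN m₁ N w * mN m₁ N w := by ring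
          _ ≤ _ := by gcongr
      have hr0 : 0 ≤ mN m₁ N (x + y + z) / (mN m₁ N x * mN m₁ N y * mN m₁ N z) := by
        have := hmpos x; have := hmpos y; have := hmpos z; have := hmpos (x + y + z)
        positivity
      have hr1 : mN m₁ N (x + y + z) / (mN m₁ N x * mN m₁ N y * mN m₁ N z) ≤
          (mN m₁ N w ^ 3)⁻¹ := by
        rw [← one_div]
        have := hmle (x + y + z)
        gcongr
      have hone : 1 ≤ (mN m₁ N w ^ 3)⁻¹ :=
        (one_le_inv₀ (by positivity)).2 (pow_le_one₀ hmw.le (hmle w))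
      have habs : |1 - mN m₁ N (x + y + z) / (mN m₁ N x * mN m₁ N y * mN m₁ N z)| ≤
          (mN m₁ N w ^ 3)⁻¹ := abs_le.2 ⟨by linarith, by linarith⟩
      have h3 : (mN m₁ N w ^ 3)⁻¹ ≤ 4 * ‖N⁻¹ • w‖ ^ (1/2 : ℝ) :=
        h.inv_pow_three_le hs (by rw [hnorm, le_div_iff₀ hN0]; linarith)
      have h4 : ‖N⁻¹ • w‖ ^ (1/2 : ℝ) = ‖w‖ ^ (1/2 : ℝ) * N ^ (-(1/2) : ℝ) := by
        rw [hnorm, Real.div_rpow hw0.le hN0.le, Real.rpow_neg hN0.le, div_eq_mul_inv]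
      have hjw := jap_sq w
      have hjs := jap_sq (x + y + z)
      have h5 := sqrt_ratio_le (j := jap w) (j₁ := jap (x + y + z)) hε hε1 hN hw.le (hj w)
        (by nlinarith [hj w]) (hj _)
        (by
          have : ‖x + y + z‖ ≤ 3 * ‖w‖ := by linarith
          have := norm_nonneg (x + y + z)
          nlinarith [hj w, hj (x + y + z)])
      rw [h4] at h3
      linarith
  have hfin : ∀ a b : ℝ, a ≤ b →
      144 * (N ^ (-1 + ε) * (jap (x + y + z) ^ (1/2 - ε/2) * (jap (x + y + z))⁻¹) * a) ≤
      144 * (N ^ (-1 + ε) * (jap (x + y + z) ^ (1/2 - ε/2) * (jap (x + y + z))⁻¹) * b) :=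
    fun a b hab => mul_le_mul_of_nonneg_left (mul_le_mul_of_nonneg_left hab hα) (by norm_num)
  rcases le_total ‖x‖ ‖y‖ with hxy | hxy
  · rcases le_total ‖y‖ ‖z‖ with hyz | hyz
    · exact (key z (hxy.trans hyz) hyz le_rfl).trans (hfin _ _ (by linarith [hβ x, hβ y]))
    · exact (key y hxy le_rfl hyz).trans (hfin _ _ (by linarith [hβ x, hβ z]))
  · rcases le_total ‖x‖ ‖z‖ with hxz | hxz
    · exact (key z hxz (hxy.trans hxz) le_rfl).trans (hfin _ _ (by linarith [hβ x, hβ y]))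
    · exact (key x le_rfl hxy hxz).trans (hfin _ _ (by linarith [hβ y, hβ z]))

/-- The quadrilinear form on the convolution hyperplane, for extended nonnegative functions. -/
def quadForm (u₁ u₂ u₃ u₄ : Rn 3 × ℝ → ENNReal) : ENNReal :=
  ∫⁻ t, ∫⁻ x, ∫⁻ y, ∫⁻ z, u₁ (-x - y - z, t) * u₂ (x, t) * u₃ (y, t) * u₄ (z, t)

/-- The squared norm of the convolution of two functions. -/
def convSq (u v : Rn 3 × ℝ → ENNReal) : ENNReal :=
  ∫⁻ η, ∫⁻ t, (∫⁻ ζ, u (η - ζ, t) * v (ζ, t)) ^ 2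

section quadForm

variable {u₁ u₂ u₃ u₄ : Rn 3 × ℝ → ENNReal}

lemma quadForm_swap_left (h₁ : Measurable u₁) (h₂ : Measurable u₂) (h₃ : Measurable u₃)
    (h₄ : Measurable u₄) : quadForm u₁ u₂ u₃ u₄ = quadForm u₁ u₃ u₂ u₄ := by
  refine lintegral_congr fun t => ?_
  rw [lintegral_lintegral_swap]
  · refine lintegral_congr fun y => lintegral_congr fun x => lintegral_congr fun z => ?_
    rw [show -x - y - z = -y - x - z by abel]; ring
  · refine (Measurable.lintegral_prod_right' (f := fun p : (Rn 3 × Rn 3) × Rn 3 =>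
      u₁ (-p.1.1 - p.1.2 - p.2, t) * u₂ (p.1.1, t) * u₃ (p.1.2, t) * u₄ (p.2, t))
      (by fun_prop)).aemeasurable

lemma quadForm_swap_right (h₁ : Measurable u₁) (h₃ : Measurable u₃)
    (h₄ : Measurable u₄) : quadForm u₁ u₂ u₃ u₄ = quadForm u₁ u₂ u₄ u₃ := by
  refine lintegral_congr fun t => lintegral_congr fun x => ?_
  rw [lintegral_lintegral_swap (by fun_prop)]
  refine lintegral_congr fun y => lintegral_congr fun z => ?_
  rw [show -x - z - y = -x - y - z by abel]; ring

lemma quadForm_sq_le (h₁ : Measurable u₁) (h₂ : Measurable u₂) (h₃ : Measurable u₃)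
    (h₄ : Measurable u₄) :
    quadForm u₁ u₂ u₃ u₄ ^ 2 ≤ convSq u₁ u₄ * convSq u₂ u₃ := by
  set X : Rn 3 × ℝ → ENNReal := fun p => ∫⁻ ζ, u₁ (p.1 - ζ, p.2) * u₄ (ζ, p.2)
  set Y : Rn 3 × ℝ → ENNReal := fun p => ∫⁻ ζ, u₂ (p.1 - ζ, p.2) * u₃ (ζ, p.2)
  have hX : Measurable X := Measurable.lintegral_prod_right' (f := fun p : (Rn 3 × ℝ) × Rn 3 =>
      u₁ (p.1.1 - p.2, p.1.2) * u₄ (p.2, p.1.2)) (by fun_prop)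
  have hY : Measurable Y := Measurable.lintegral_prod_right' (f := fun p : (Rn 3 × ℝ) × Rn 3 =>
      u₂ (p.1.1 - p.2, p.1.2) * u₃ (p.2, p.1.2)) (by fun_prop)
  have hXn : Measurable fun p : Rn 3 × ℝ => X (-p.1, p.2) := hX.comp (by fun_prop)
  have h : quadForm u₁ u₂ u₃ u₄ = ∫⁻ p : Rn 3 × ℝ, X (-p.1, p.2) * Y p := by
    rw [Measure.volume_eq_prod, lintegral_prod_symm (fun p : Rn 3 × ℝ => X (-p.1, p.2) * Y p)
      (hXn.mul hY).aemeasurable]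
    refine lintegral_congr fun t => ?_
    rw [lintegral_lintegral_swap (by
      refine (Measurable.lintegral_prod_right' (f := fun p : (Rn 3 × Rn 3) × Rn 3 =>
        u₁ (-p.1.1 - p.1.2 - p.2, t) * u₂ (p.1.1, t) * u₃ (p.1.2, t) * u₄ (p.2, t))
        (by fun_prop)).aemeasurable)]
    have : ∀ y : Rn 3, ∫⁻ x, ∫⁻ z, u₁ (-x - y - z, t) * u₂ (x, t) * u₃ (y, t) * u₄ (z, t) =
        ∫⁻ η, X (-η, t) * (u₂ (η - y, t) * u₃ (y, t)) := by
      intro y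
      rw [← lintegral_sub_right_eq_self _ y]
      refine lintegral_congr fun η => ?_
      simp only [X]
      rw [← lintegral_mul_const _ (by fun_prop)]
      refine lintegral_congr fun z => ?_
      rw [show -(η - y) - y - z = -η - z by abel]; ring
    simp only [this]
    rw [lintegral_lintegral_swap]
    · refine lintegral_congr fun η => ?_
      rw [lintegral_const_mul _ (by fun_prop)]
    · refine Measurable.aemeasurable (Measurable.mul (hX.comp (by fun_prop)) (by fun_prop))
  rw [h]
  refine (lintegral_sq_le_of_sq_le_mul (A := fun p : Rn 3 × ℝ => X (-p.1, p.2) ^ 2)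
    (B := fun p => Y p ^ 2) (hXn.pow_const 2).aemeasurable (hY.pow_const 2).aemeasurable
    (ae_of_all _ fun p => (mul_pow _ _ _).le)).trans (le_of_eq ?_)
  rw [Measure.volume_eq_prod, lintegral_prod _ (hXn.pow_const 2).aemeasurable,
    lintegral_prod _ (hY.pow_const 2).aemeasurable]
  congr 1
  exact lintegral_neg_eq_self (μ := volume) fun η => ∫⁻ t, X (η, t) ^ 2

end quadForm

lemma rapidDecay_schwartzMap (ψ : SchwartzMap (Rn 3 × ℝ) ℂ) : RapidDecay ψ := by
  refine ⟨ψ.continuous, ?_⟩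
  have h := fun x => SchwartzMap.one_add_le_sup_seminorm_apply (𝕜 := ℝ) (m := (8, 0)) (k := 8)
    (n := 0) le_rfl le_rfl ψ x
  set C : ℝ := 2 ^ 8 * ((Finset.Iic (8, 0)).sup fun m => SchwartzMap.seminorm ℝ m.1 m.2) ψ
  refine ⟨C, by positivity, fun x => ?_⟩
  have hx := h x
  rw [norm_iteratedFDeriv_zero] at hx
  have h1 : ‖x.1‖ ≤ ‖x‖ := norm_fst_le x
  have h2 : |x.2| ≤ ‖x‖ := norm_snd_le x
  have h3 : (1 + ‖x.1‖ ^ 2) ^ 3 * (1 + x.2 ^ 2) ≤ (1 + ‖x‖) ^ 8 := by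
    have h4 : 1 + ‖x.1‖ ^ 2 ≤ (1 + ‖x‖) ^ 2 := by nlinarith [norm_nonneg x.1]
    have h5 : 1 + x.2 ^ 2 ≤ (1 + ‖x‖) ^ 2 := by nlinarith [sq_abs x.2, abs_nonneg x.2]
    calc _ ≤ ((1 + ‖x‖) ^ 2) ^ 3 * (1 + ‖x‖) ^ 2 := by gcongr
      _ = _ := by ring
  rw [mul_assoc, ← mul_inv, ← div_eq_mul_inv, le_div_iff₀ (by positivity), mul_comm]
  exact (mul_le_mul_of_nonneg_right h3 (norm_nonneg _)).trans hx

lemma integrable_rapidDecay_bound :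
    Integrable fun x : Rn 3 × ℝ => ((1 + ‖x.1‖ ^ 2) ^ 3)⁻¹ * (1 + x.2 ^ 2)⁻¹ := by
  rw [Measure.volume_eq_prod]
  exact integrable_inv_one_add_sq_pow_three.mul_prod integrable_inv_one_add_sq

lemma RapidDecay.integrable {Ψ : Rn 3 × ℝ → ℂ} (h : RapidDecay Ψ) : Integrable Ψ := by
  obtain ⟨hc, C, hC, hd⟩ := h
  refine (integrable_rapidDecay_bound.const_mul C).mono' hc.aestronglyMeasurable
    (ae_of_all _ fun x => ?_)
  rw [← mul_assoc]
  exact hd x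

/-- The identification of the Hilbert product of space and time with the product. -/
def spaceTimeEquiv : WithLp 2 (Rn 3 × ℝ) ≃L[ℝ] Rn 3 × ℝ :=
  WithLp.prodContinuousLinearEquiv 2 ℝ (Rn 3) ℝ

/-- A Schwartz function on the product, regarded on the Hilbert product. -/
def schwartzLift (ψ : SchwartzMap (Rn 3 × ℝ) ℂ) : SchwartzMap (WithLp 2 (Rn 3 × ℝ)) ℂ :=
  SchwartzMap.compCLMOfContinuousLinearEquiv ℝ spaceTimeEquiv ψ

lemma schwartzLift_apply (ψ : SchwartzMap (Rn 3 × ℝ) ℂ) (z : WithLp 2 (Rn 3 × ℝ)) :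
    schwartzLift ψ z = ψ z.ofLp := rfl

lemma norm_cexp_I_mul_ofReal (r : ℝ) : ‖cexp (I * (r : ℂ))‖ = 1 := by
  rw [mul_comm, Complex.norm_exp_ofReal_mul_I]

lemma integrable_phase_mul (ψ : SchwartzMap (Rn 3 × ℝ) ℂ) (ξ : Rn 3) (τ : ℝ) :
    Integrable fun z : Rn 3 × ℝ =>
      cexp (I * ((-2 * Real.pi * (⟪z.1, ξ⟫ + z.2 * τ) : ℝ) : ℂ)) • ψ z := by
  refine (rapidDecay_schwartzMap ψ).integrable.mono (by
    have := ψ.continuous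
    exact Continuous.aestronglyMeasurable (by fun_prop)) (ae_of_all _ fun z => ?_)
  rw [norm_smul, norm_cexp_I_mul_ofReal, one_mul]

lemma stFourier_eq_integral_prod (ψ : SchwartzMap (Rn 3 × ℝ) ℂ) (ξ : Rn 3) (τ : ℝ) :
    stFourier 3 (fun x t => ψ (x, t)) ξ τ = ∫ z : Rn 3 × ℝ,
      cexp (I * ((-2 * Real.pi * (⟪z.1, ξ⟫ + z.2 * τ) : ℝ) : ℂ)) • ψ z := by
  rw [Measure.volume_eq_prod, integral_prod _ (integrable_phase_mul ψ ξ τ)]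
  rfl

lemma stFourier_eq_fourier_schwartzLift (ψ : SchwartzMap (Rn 3 × ℝ) ℂ) (ξ : Rn 3) (τ : ℝ) :
    stFourier 3 (fun x t => ψ (x, t)) ξ τ = 𝓕 (schwartzLift ψ) (WithLp.toLp 2 (ξ, τ)) := by
  rw [stFourier_eq_integral_prod, SchwartzMap.fourier_coe, Real.fourier_eq',
    ← (WithLp.volume_preserving_ofLp (Rn 3) ℝ).integral_comp
      (MeasurableEquiv.toLp 2 (Rn 3 × ℝ)).symm.measurableEmbedding]
  refine integral_congr_ae (ae_of_all _ fun z => ?_)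
  simp only [schwartzLift_apply, WithLp.prod_inner_apply]
  congr 2
  rw [mul_comm I]
  congr 3
  simp [mul_comm]

/-- The space-time Fourier transform of a Schwartz function, as a Schwartz function. -/
def stFourierSchwartz (ψ : SchwartzMap (Rn 3 × ℝ) ℂ) : SchwartzMap (Rn 3 × ℝ) ℂ :=
  SchwartzMap.compCLMOfContinuousLinearEquiv ℝ spaceTimeEquiv.symm (𝓕 (schwartzLift ψ))

lemma stFourierSchwartz_apply (ψ : SchwartzMap (Rn 3 × ℝ) ℂ) (ξ : Rn 3) (τ : ℝ) :
    stFourierSchwartz ψ (ξ, τ) = stFourier 3 (fun x t => ψ (x, t)) ξ τ :=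
  (stFourier_eq_fourier_schwartzLift ψ ξ τ).symm

lemma continuous_fourier_slice (ψ : SchwartzMap (Rn 3 × ℝ) ℂ) (ξ : Rn 3) :
    Continuous fun t : ℝ => 𝓕 (fun x => ψ (x, t)) ξ := by
  obtain ⟨hc, C, hC, hd⟩ := rapidDecay_schwartzMap ψ
  simp only [Real.fourier_eq']
  refine continuous_of_dominated (bound := fun x : Rn 3 => C * ((1 + ‖x‖ ^ 2) ^ 3)⁻¹)
    (fun t => Continuous.aestronglyMeasurable (by fun_prop)) (fun t => ae_of_all _ fun x => ?_)
    (integrable_inv_one_add_sq_pow_three.const_mul C) (ae_of_all _ fun x => by fun_prop)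
  rw [norm_smul, Complex.norm_exp_ofReal_mul_I, one_mul]
  refine (hd (x, t)).trans (mul_le_of_le_one_right (by positivity) ?_)
  exact inv_le_one_of_one_le₀ (by nlinarith [sq_nonneg t])

lemma integrable_fourier_slice (ψ : SchwartzMap (Rn 3 × ℝ) ℂ) (ξ : Rn 3) :
    Integrable fun t : ℝ => 𝓕 (fun x => ψ (x, t)) ξ := by
  have h := (integrable_phase_mul ψ ξ 0)
  rw [Measure.volume_eq_prod] at h
  have h2 := h.integral_prod_right
  refine h2.congr (ae_of_all _ fun t => ?_)
  simp only [Real.fourier_eq']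
  refine integral_congr_ae (ae_of_all _ fun x => ?_)
  simp [mul_comm]

lemma fourier_fourier_slice (ψ : SchwartzMap (Rn 3 × ℝ) ℂ) (ξ : Rn 3) (τ : ℝ) :
    𝓕 (fun t : ℝ => 𝓕 (fun x => ψ (x, t)) ξ) τ = stFourierSchwartz ψ (ξ, τ) := by
  rw [stFourierSchwartz_apply, stFourier_eq_integral_prod, Measure.volume_eq_prod,
    integral_prod_symm _ (integrable_phase_mul ψ ξ τ), Real.fourier_eq']
  refine integral_congr_ae (ae_of_all _ fun t => ?_)
  simp only [Real.fourier_eq']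
  rw [← integral_smul]
  refine integral_congr_ae (ae_of_all _ fun x => ?_)
  simp only [smul_smul, ← Complex.exp_add]
  congr 2
  simp
  ring

/-- Fourier inversion in time. -/
lemma fourier_slice_eq (ψ : SchwartzMap (Rn 3 × ℝ) ℂ) (ξ : Rn 3) (t : ℝ) :
    𝓕 (fun x => ψ (x, t)) ξ = 𝓕 (fun τ => stFourierSchwartz ψ (ξ, τ)) (-t) := by
  have h : 𝓕 (fun t : ℝ => 𝓕 (fun x => ψ (x, t)) ξ) = fun τ => stFourierSchwartz ψ (ξ, τ) :=
    funext (fourier_fourier_slice ψ ξ)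
  have := Continuous.fourierInv_fourier_eq (continuous_fourier_slice ψ ξ)
    (integrable_fourier_slice ψ ξ)
    (by rw [h]; exact (rapidDecay_schwartzMap (stFourierSchwartz ψ)).integrable_snd ξ)
  rw [← congrFun this t, h, Real.fourierInv_eq_fourier_neg]

lemma stFourierSchwartz_lineDerivOp (ψ : SchwartzMap (Rn 3 × ℝ) ℂ) (v ξ : Rn 3) (τ : ℝ) :
    stFourierSchwartz (LineDeriv.lineDerivOp (v, (0 : ℝ)) ψ) (ξ, τ) =
      (2 * Real.pi * I) * ((⟪ξ, v⟫ : ℝ) * stFourierSchwartz ψ (ξ, τ)) := by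
  have h : schwartzLift (LineDeriv.lineDerivOp (v, (0 : ℝ)) ψ) =
      LineDeriv.lineDerivOp (WithLp.toLp 2 (v, (0 : ℝ))) (schwartzLift ψ) := by
    ext z
    rw [SchwartzMap.lineDerivOp_apply, schwartzLift_apply, SchwartzMap.lineDerivOp_apply]
    rfl
  rw [stFourierSchwartz_apply, stFourier_eq_fourier_schwartzLift, stFourierSchwartz_apply,
    stFourier_eq_fourier_schwartzLift, h, SchwartzMap.fourier_lineDerivOp_eq]
  rw [smul_apply, SchwartzMap.smulLeftCLM_apply_apply (by fun_prop)]
  simp [WithLp.prod_inner_apply]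

lemma gradC_apply (ψ : SchwartzMap (Rn 3 × ℝ) ℂ) (x : Rn 3) (t : ℝ) (i : Fin 3) :
    gradC (fun y => ψ (y, t)) x i =
      LineDeriv.lineDerivOp (EuclideanSpace.single i (1 : ℝ), (0 : ℝ)) ψ (x, t) := by
  rw [SchwartzMap.lineDerivOp_apply_eq_fderiv]
  have h : HasFDerivAt (fun y : Rn 3 => ψ (y, t))
      ((fderiv ℝ ψ (x, t)).comp (ContinuousLinearMap.inl ℝ (Rn 3) ℝ)) x :=
    (ψ.differentiableAt.hasFDerivAt (x := (x, t))).comp x (hasFDerivAt_prodMk_left x t)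
  show fderiv ℝ (fun y => ψ (y, t)) x (EuclideanSpace.single i 1) = _
  rw [h.fderiv]
  rfl

lemma stFourier_gradC_apply (ψ : SchwartzMap (Rn 3 × ℝ) ℂ) (ξ : Rn 3) (τ : ℝ) (i : Fin 3) :
    stFourier 3 (fun x t => gradC (fun y => ψ (y, t)) x) ξ τ i =
      (2 * Real.pi * I) * (ξ i * stFourierSchwartz ψ (ξ, τ)) := by
  have hint := fun i : Fin 3 => integrable_phase_mul
    (LineDeriv.lineDerivOp (EuclideanSpace.single i (1 : ℝ), (0 : ℝ)) ψ) ξ τ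
  have hin : ∀ x : Rn 3, ∀ i : Fin 3, Integrable fun t : ℝ =>
      cexp (I * ((-2 * Real.pi * (⟪x, ξ⟫ + t * τ) : ℝ) : ℂ)) •
        LineDeriv.lineDerivOp (EuclideanSpace.single i (1 : ℝ), (0 : ℝ)) ψ (x, t) := by
    intro x i
    have hr := rapidDecay_schwartzMap
      (LineDeriv.lineDerivOp (EuclideanSpace.single i (1 : ℝ), (0 : ℝ)) ψ)
    refine (hr.integrable_snd x).mono (Continuous.aestronglyMeasurable ?_)
      (ae_of_all _ fun t => ?_)
    · have := hr.1
      fun_prop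
    · rw [norm_smul, norm_cexp_I_mul_ofReal, one_mul]
  have hslice : ∀ x : Rn 3, ∀ i : Fin 3, (∫ t : ℝ,
      cexp (I * ((-2 * Real.pi * (⟪x, ξ⟫ + t * τ) : ℝ) : ℂ)) •
        gradC (fun y => ψ (y, t)) x) i = ∫ t : ℝ,
      cexp (I * ((-2 * Real.pi * (⟪x, ξ⟫ + t * τ) : ℝ) : ℂ)) •
        LineDeriv.lineDerivOp (EuclideanSpace.single i (1 : ℝ), (0 : ℝ)) ψ (x, t) := by
    intro x i
    rw [eval_integral_piLp]
    · simp only [PiLp.smul_apply, gradC_apply]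
    · intro j
      simpa only [PiLp.smul_apply, gradC_apply] using hin x j
  rw [stFourier, eval_integral_piLp]
  · simp only [hslice]
    have := stFourierSchwartz_lineDerivOp ψ (EuclideanSpace.single i (1 : ℝ)) ξ τ
    rw [stFourierSchwartz_apply, stFourier] at this
    rw [this, real_inner_comm, EuclideanSpace.inner_single_left]
    simp
  · intro j
    simp only [hslice]
    have := hint j
    rw [Measure.volume_eq_prod] at this
    exact this.integral_prod_left

lemma norm_stFourier_gradC_sq (ψ : SchwartzMap (Rn 3 × ℝ) ℂ) (ξ : Rn 3) (τ : ℝ) :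
    ‖stFourier 3 (fun x t => gradC (fun y => ψ (y, t)) x) ξ τ‖ ^ 2 =
      (2 * Real.pi) ^ 2 * (‖ξ‖ ^ 2 * ‖stFourierSchwartz ψ (ξ, τ)‖ ^ 2) := by
  rw [EuclideanSpace.norm_sq_eq, EuclideanSpace.norm_sq_eq, Finset.sum_mul, Finset.mul_sum]
  refine Finset.sum_congr rfl fun i _ => ?_
  rw [stFourier_gradC_apply]
  simp only [norm_mul, Complex.norm_real, Complex.norm_I, Complex.norm_ofNat, Real.norm_eq_abs,
    abs_of_pos Real.pi_pos]
  ring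


lemma integrable_wDensity_real {q : ℝ} (hq : q ≤ 2) {p : Rn 3 → ℝ} (hp : Continuous p)
    (hpj : ∀ x, 0 ≤ p x ∧ p x ≤ jap x) {Ψ : Rn 3 × ℝ → ℂ} (h : RapidDecay Ψ) :
    Integrable fun x : Rn 3 × ℝ =>
      p x.1 ^ 2 * japR (x.2 - ‖x.1‖ ^ 2) ^ q * ‖Ψ x‖ ^ 2 := by
  obtain ⟨hc, C, hC, hd⟩ := h
  have hjc : Continuous fun x : Rn 3 × ℝ => japR (x.2 - ‖x.1‖ ^ 2) ^ q :=
    (continuous_japR.comp (by fun_prop)).rpow_const fun x => Or.inl (japR_pos _).ne'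
  refine (integrable_rapidDecay_bound.const_mul (2 * C ^ 2)).mono'
    (Continuous.aestronglyMeasurable (by fun_prop)) (ae_of_all _ fun x => ?_)
  have hj := japR_pos (x.2 - ‖x.1‖ ^ 2)
  have hq2 : japR (x.2 - ‖x.1‖ ^ 2) ^ q ≤ 2 * ((1 + ‖x.1‖ ^ 2) ^ 2 * (1 + x.2 ^ 2)) := by
    calc _ ≤ japR (x.2 - ‖x.1‖ ^ 2) ^ (2 : ℝ) :=
          Real.rpow_le_rpow_of_exponent_le (one_le_japR _) hq
      _ = 1 + (x.2 - ‖x.1‖ ^ 2) ^ 2 := by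
          rw [Real.rpow_two, japR, Real.sq_sqrt (by positivity)]
      _ ≤ _ := by
          nlinarith [sq_nonneg (x.2 + ‖x.1‖ ^ 2), mul_nonneg (sq_nonneg ‖x.1‖) (sq_nonneg x.2),
            mul_nonneg (sq_nonneg (‖x.1‖ ^ 2)) (sq_nonneg x.2), sq_nonneg ‖x.1‖, sq_nonneg x.2]
  have hp2 : p x.1 ^ 2 ≤ 1 + ‖x.1‖ ^ 2 := by
    rw [← jap_sq]
    exact pow_le_pow_left₀ (hpj _).1 (hpj _).2 2
  rw [Real.norm_of_nonneg (by positivity)]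
  have hX : 0 < 1 + ‖x.1‖ ^ 2 := by positivity
  have hT : 0 < 1 + x.2 ^ 2 := by positivity
  calc _ ≤ (1 + ‖x.1‖ ^ 2) * (2 * ((1 + ‖x.1‖ ^ 2) ^ 2 * (1 + x.2 ^ 2))) *
        (C * ((1 + ‖x.1‖ ^ 2) ^ 3)⁻¹ * (1 + x.2 ^ 2)⁻¹) ^ 2 := by
        gcongr
        exact hd x
    _ = _ := by field_simp

lemma wL2_eq_ofReal_integral {q : ℝ} (hq : q ≤ 2) {p : Rn 3 → ℝ} (hp : Continuous p)
    (hpj : ∀ x, 0 ≤ p x ∧ p x ≤ jap x) {Ψ : Rn 3 × ℝ → ℂ} (h : RapidDecay Ψ) :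
    wL2 q p Ψ = ENNReal.ofReal (∫ ξ : Rn 3, ∫ τ : ℝ,
      p ξ ^ 2 * japR (τ - ‖ξ‖ ^ 2) ^ q * ‖Ψ (ξ, τ)‖ ^ 2) := by
  have hi := integrable_wDensity_real hq hp hpj h
  have hj := fun x : Rn 3 × ℝ => Real.rpow_nonneg (japR_pos (x.2 - ‖x.1‖ ^ 2)).le q
  rw [← integral_prod (fun x : Rn 3 × ℝ => p x.1 ^ 2 * japR (x.2 - ‖x.1‖ ^ 2) ^ q * ‖Ψ x‖ ^ 2)
    (by rwa [← Measure.volume_eq_prod]), ← Measure.volume_eq_prod,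
    ofReal_integral_eq_lintegral_ofReal hi (ae_of_all _ fun x => by
      have := hj x
      positivity)]
  refine lintegral_congr fun x => ?_
  have := hj x
  rw [wDensity, ← ofReal_norm, ← ENNReal.ofReal_pow (norm_nonneg _),
    ← ENNReal.ofReal_mul (by positivity)]

lemma XNorm_nonneg {E : Type*} [NormedAddCommGroup E] [NormedSpace ℂ E] (s b : ℝ)
    (ψ : Rn 3 → ℝ → E) : 0 ≤ XNorm 3 s b ψ :=
  Real.rpow_nonneg (integral_nonneg fun ξ => integral_nonneg fun _ =>
    mul_nonneg (mul_nonneg (Real.rpow_nonneg (jap_pos ξ).le _)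
      (Real.rpow_nonneg (japR_pos _).le _)) (sq_nonneg _)) _

lemma XNorm_sq {E : Type*} [NormedAddCommGroup E] [NormedSpace ℂ E] (s b : ℝ)
    (ψ : Rn 3 → ℝ → E) : XNorm 3 s b ψ ^ 2 = ∫ ξ : Rn 3, ∫ τ : ℝ,
      jap ξ ^ (2 * s) * japR (τ - ‖ξ‖ ^ 2) ^ (2 * b) * ‖stFourier 3 ψ ξ τ‖ ^ 2 := by
  rw [XNorm, ← Real.rpow_natCast, ← Real.rpow_mul]
  · norm_num
  · exact integral_nonneg fun ξ => integral_nonneg fun τ =>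
      mul_nonneg (mul_nonneg (Real.rpow_nonneg (jap_pos ξ).le _)
        (Real.rpow_nonneg (japR_pos _).le _)) (sq_nonneg _)

lemma continuous_inv_jap : Continuous fun x : Rn 3 => (jap x)⁻¹ :=
  continuous_jap.inv₀ fun x => (jap_pos x).ne'

lemma inv_jap_mem (x : Rn 3) : 0 ≤ (jap x)⁻¹ ∧ (jap x)⁻¹ ≤ jap x :=
  ⟨inv_nonneg.2 (jap_pos x).le, (inv_le_one_of_one_le₀ (one_le_jap x)).trans (one_le_jap x)⟩

lemma wL2_inv_jap {ε : ℝ} (hε : ε < 1/2) (ψ : SchwartzMap (Rn 3 × ℝ) ℂ) :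
    wL2 (1 + 2 * ε) (fun x => (jap x)⁻¹) (stFourierSchwartz ψ) =
      ENNReal.ofReal (XNorm 3 (-1) (1/2 + ε) (fun x t => ψ (x, t)) ^ 2) := by
  rw [wL2_eq_ofReal_integral (by linarith) continuous_inv_jap inv_jap_mem
    (rapidDecay_schwartzMap _), XNorm_sq]
  congr 1
  refine integral_congr_ae (ae_of_all _ fun ξ => integral_congr_ae (ae_of_all _ fun τ => ?_))
  simp only
  rw [stFourierSchwartz_apply, show (2:ℝ) * (-1) = -(2:ℕ) by norm_num,
    Real.rpow_neg (jap_pos ξ).le, Real.rpow_natCast, inv_pow,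
    show 2 * (1/2 + ε) = 1 + 2 * ε by ring]

lemma wL2_norm_le {ε : ℝ} (hε : ε < 1/2) (ψ : SchwartzMap (Rn 3 × ℝ) ℂ) :
    wL2 (1 + 2 * ε) (fun x => ‖x‖) (stFourierSchwartz ψ) ≤
      ENNReal.ofReal (XNorm 3 0 (1/2 + ε) (fun x t => gradC (fun y => ψ (y, t)) x) ^ 2) := by
  have h : XNorm 3 0 (1/2 + ε) (fun x t => gradC (fun y => ψ (y, t)) x) ^ 2 =
      (2 * Real.pi) ^ 2 * ∫ ξ : Rn 3, ∫ τ : ℝ,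
        ‖ξ‖ ^ 2 * japR (τ - ‖ξ‖ ^ 2) ^ (1 + 2 * ε) * ‖stFourierSchwartz ψ (ξ, τ)‖ ^ 2 := by
    rw [XNorm_sq]
    simp only [← integral_const_mul]
    refine integral_congr_ae (ae_of_all _ fun ξ => integral_congr_ae (ae_of_all _ fun τ => ?_))
    simp only
    rw [norm_stFourier_gradC_sq, mul_zero, Real.rpow_zero,
      show 2 * (1/2 + ε) = 1 + 2 * ε by ring]
    ring
  rw [wL2_eq_ofReal_integral (by linarith) continuous_norm
    (fun x => ⟨norm_nonneg x, norm_le_jap x⟩) (rapidDecay_schwartzMap _), h]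
  refine ENNReal.ofReal_le_ofReal (le_mul_of_one_le_left ?_ ?_)
  · exact integral_nonneg fun ξ => integral_nonneg fun τ => by
      have := Real.rpow_nonneg (japR_pos (τ - ‖ξ‖ ^ 2)).le (1 + 2 * ε)
      positivity
  · nlinarith [Real.pi_gt_three]

/-- The modulus of the Fourier transform in the second variable. -/
def timeFourier (f : Rn 3 × ℝ → ℂ) (x : Rn 3 × ℝ) : ENNReal := ‖𝓕 (fun τ => f (x.1, τ)) x.2‖ₑ

/-- `timeFourier` with the weight `⟨ξ⟩^(1/2-θ) p(ξ)` of the bilinear estimate. -/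
def weightedTimeFourier (θ : ℝ) (p : Rn 3 → ℝ) (f : Rn 3 × ℝ → ℂ) (x : Rn 3 × ℝ) : ENNReal :=
  ENNReal.ofReal (jap x.1 ^ (1/2 - θ) * p x.1) * timeFourier f x

/-- Rapidly decaying functions whose Fourier transform in the second variable is nonnegative. -/
def NonnegTimeFourier (f : Rn 3 × ℝ → ℂ) : Prop :=
  RapidDecay f ∧ ∀ ξ t, 0 ≤ (𝓕 (fun τ => f (ξ, τ)) t).re ∧ (𝓕 (fun τ => f (ξ, τ)) t).im = 0

lemma RapidDecay.measurable_timeFourier {f : Rn 3 × ℝ → ℂ} (h : RapidDecay f) :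
    Measurable (timeFourier f) := h.measurable_fourier.enorm

lemma RapidDecay.measurable_weightedTimeFourier {θ : ℝ} {p : Rn 3 → ℝ} (hp : Continuous p)
    {f : Rn 3 × ℝ → ℂ} (h : RapidDecay f) : Measurable (weightedTimeFourier θ p f) := by
  have hj : Continuous fun x : Rn 3 × ℝ => jap x.1 ^ (1/2 - θ) * p x.1 :=
    ((continuous_jap.comp continuous_fst).rpow_const fun x => Or.inl (jap_pos _).ne').mul
      (hp.comp continuous_fst)
  exact hj.measurable.ennreal_ofReal.mul h.measurable_timeFourier

/-- Quadrilinear estimate with the derivative weight on the second factor. -/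
lemma exists_quadForm_sq_le {q θ : ℝ} (hq : 1 < q) (h0 : 0 < θ) (h1 : θ < 1/2) :
    ∃ K : ENNReal, K < ⊤ ∧ ∀ f₁ f₂ f₃ f₄ : Rn 3 × ℝ → ℂ, NonnegTimeFourier f₁ →
      NonnegTimeFourier f₂ → NonnegTimeFourier f₃ → NonnegTimeFourier f₄ →
      quadForm (weightedTimeFourier θ (fun x => (jap x)⁻¹) f₁)
        (weightedTimeFourier θ (fun x => ‖x‖) f₂) (timeFourier f₃) (timeFourier f₄) ^ 2 ≤
      K ^ 2 * (wL2 q (fun x => (jap x)⁻¹) f₁ * wL2 q (fun x => ‖x‖) f₂ *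
        wL2 q (fun x => ‖x‖) f₃ * wL2 q (fun x => ‖x‖) f₄) := by
  obtain ⟨K, hK, h⟩ := exists_bilinear_le hq h0 h1
  refine ⟨K, hK, fun f₁ f₂ f₃ f₄ hf₁ hf₂ hf₃ hf₄ => ?_⟩
  refine (quadForm_sq_le (hf₁.1.measurable_weightedTimeFourier continuous_inv_jap)
    (hf₂.1.measurable_weightedTimeFourier continuous_norm) hf₃.1.measurable_timeFourier
    hf₄.1.measurable_timeFourier).trans ?_
  refine (mul_le_mul' (h _ continuous_inv_jap inv_jap_mem f₁ f₄ hf₁.1 hf₄.1 hf₁.2 hf₄.2)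
    (h _ continuous_norm (fun x => ⟨norm_nonneg x, norm_le_jap x⟩) f₂ f₃ hf₂.1 hf₃.1 hf₂.2
      hf₃.2)).trans (le_of_eq ?_)
  ring

lemma lintegral_four_add {F G : ℝ → Rn 3 → Rn 3 → Rn 3 → ENNReal}
    (hF : Measurable fun p : ((ℝ × Rn 3) × Rn 3) × Rn 3 => F p.1.1.1 p.1.1.2 p.1.2 p.2) :
    ∫⁻ t, ∫⁻ x, ∫⁻ y, ∫⁻ z, (F t x y z + G t x y z) =
      (∫⁻ t, ∫⁻ x, ∫⁻ y, ∫⁻ z, F t x y z) + ∫⁻ t, ∫⁻ x, ∫⁻ y, ∫⁻ z, G t x y z := by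
  have h2 : Measurable fun p : (ℝ × Rn 3) × Rn 3 => ∫⁻ z, F p.1.1 p.1.2 p.2 z :=
    hF.lintegral_prod_right'
  have h3 : Measurable fun p : ℝ × Rn 3 => ∫⁻ y, ∫⁻ z, F p.1 p.2 y z := h2.lintegral_prod_right'
  have h4 : Measurable fun t : ℝ => ∫⁻ x, ∫⁻ y, ∫⁻ z, F t x y z := h3.lintegral_prod_right'
  have h5 : ∀ t, Measurable fun x => ∫⁻ y, ∫⁻ z, F t x y z := fun t => h3.comp (measurable_prodMk_left (x := t))
  have h6 : ∀ t x, Measurable fun y => ∫⁻ z, F t x y z := fun t x => 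
    h2.comp (measurable_prodMk_left (x := (t, x)))
  have h7 : ∀ t x y, Measurable fun z => F t x y z := fun t x y => 
    hF.comp (measurable_prodMk_left (x := ((t, x), y)))
  simp only [← lintegral_add_left h4, ← lintegral_add_left (h5 _), ← lintegral_add_left (h6 _ _),
    ← lintegral_add_left (h7 _ _ _)]

lemma enorm_integral_four_le (S : Set ℝ) (F : ℝ → Rn 3 → Rn 3 → Rn 3 → ℂ) :
    ‖∫ t in S, ∫ x, ∫ y, ∫ z, F t x y z‖ₑ ≤ ∫⁻ t, ∫⁻ x, ∫⁻ y, ∫⁻ z, ‖F t x y z‖ₑ := by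
  refine (enorm_integral_le_lintegral_enorm _).trans ((setLIntegral_le_lintegral S _).trans ?_)
  refine lintegral_mono fun t => (enorm_integral_le_lintegral_enorm _).trans ?_
  refine lintegral_mono fun x => (enorm_integral_le_lintegral_enorm _).trans ?_
  exact lintegral_mono fun y => enorm_integral_le_lintegral_enorm _

lemma enorm_fourier_slice (φ : SchwartzMap (Rn 3 × ℝ) ℂ) (ξ : Rn 3) (t : ℝ) :
    ‖𝓕 (fun x => φ (x, t)) ξ‖ₑ = timeFourier (stFourierSchwartz φ) (ξ, -t) := by
  rw [fourier_slice_eq, timeFourier]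

lemma nonnegTimeFourier_stFourierSchwartz {φ : SchwartzMap (Rn 3 × ℝ) ℂ}
    (h : ∀ t : ℝ, ∀ ξ : Rn 3,
      0 ≤ (𝓕 (fun x => φ (x, t)) ξ).re ∧ (𝓕 (fun x => φ (x, t)) ξ).im = 0) :
    NonnegTimeFourier (stFourierSchwartz φ) := by
  refine ⟨rapidDecay_schwartzMap _, fun ξ t => ?_⟩
  have := h (-t) ξ
  rwa [fourier_slice_eq, neg_neg] at this

/-- The commutator form is controlled by three weighted quadrilinear forms. -/
lemma enorm_commutator_le {s : ℝ} {m₁ : Rn 3 → ℝ} (hs : 5/6 < s)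
    (h : IsAdmissibleMultiplier 3 s m₁) {ε N : ℝ} (hε : 0 < ε) (hε1 : ε < 1/2) (hN : 1 ≤ N)
    (S : Set ℝ) (φ₁ φ₂ φ₃ φ₄ : SchwartzMap (Rn 3 × ℝ) ℂ)
    {A A₂ A₃ A₄ B₂ B₃ B₄ : Rn 3 × ℝ → ENNReal}
    (hA : A = weightedTimeFourier (ε/2) (fun x => (jap x)⁻¹) (stFourierSchwartz φ₁))
    (hA₂ : A₂ = timeFourier (stFourierSchwartz φ₂)) (hA₃ : A₃ = timeFourier (stFourierSchwartz φ₃))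
    (hA₄ : A₄ = timeFourier (stFourierSchwartz φ₄))
    (hB₂ : B₂ = weightedTimeFourier (ε/2) (fun x => ‖x‖) (stFourierSchwartz φ₂))
    (hB₃ : B₃ = weightedTimeFourier (ε/2) (fun x => ‖x‖) (stFourierSchwartz φ₃))
    (hB₄ : B₄ = weightedTimeFourier (ε/2) (fun x => ‖x‖) (stFourierSchwartz φ₄)) :
    ‖∫ t in S, ∫ ξ₂ : Rn 3, ∫ ξ₃ : Rn 3, ∫ ξ₄ : Rn 3,
        ((1 - mN m₁ N (ξ₂ + ξ₃ + ξ₄) /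
            (mN m₁ N ξ₂ * mN m₁ N ξ₃ * mN m₁ N ξ₄) : ℝ) : ℂ) *
          𝓕 (fun x => φ₁ (x, t)) (-ξ₂ - ξ₃ - ξ₄) *
          𝓕 (fun x => φ₂ (x, t)) ξ₂ *
          𝓕 (fun x => φ₃ (x, t)) ξ₃ *
          𝓕 (fun x => φ₄ (x, t)) ξ₄‖ₑ ≤
      ENNReal.ofReal (144 * N ^ (-1 + ε)) *
        (quadForm A B₂ A₃ A₄ + quadForm A A₂ B₃ A₄ + quadForm A A₂ A₃ B₄) := by
  have hr := fun φ => rapidDecay_schwartzMap (stFourierSchwartz φ)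
  have mA : Measurable A := hA ▸ (hr φ₁).measurable_weightedTimeFourier continuous_inv_jap
  have mA₂ : Measurable A₂ := hA₂ ▸ (hr φ₂).measurable_timeFourier
  have mA₃ : Measurable A₃ := hA₃ ▸ (hr φ₃).measurable_timeFourier
  have mA₄ : Measurable A₄ := hA₄ ▸ (hr φ₄).measurable_timeFourier
  have mB₂ : Measurable B₂ := hB₂ ▸ (hr φ₂).measurable_weightedTimeFourier continuous_norm
  have mB₃ : Measurable B₃ := hB₃ ▸ (hr φ₃).measurable_weightedTimeFourier continuous_norm
  set c : ENNReal := ENNReal.ofReal (144 * N ^ (-1 + ε)) with hc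
  have hsum : c * (quadForm A B₂ A₃ A₄ + quadForm A A₂ B₃ A₄ + quadForm A A₂ A₃ B₄) =
      ∫⁻ t, ∫⁻ x, ∫⁻ y, ∫⁻ z, c *
        (A (-x - y - z, t) * B₂ (x, t) * A₃ (y, t) * A₄ (z, t) +
        (A (-x - y - z, t) * A₂ (x, t) * B₃ (y, t) * A₄ (z, t) +
         A (-x - y - z, t) * A₂ (x, t) * A₃ (y, t) * B₄ (z, t))) := by
    simp only [lintegral_const_mul' c _ ENNReal.ofReal_ne_top]
    rw [lintegral_four_add (by fun_prop), lintegral_four_add (by fun_prop), add_assoc]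
    rfl
  refine (enorm_integral_four_le S _).trans ?_
  rw [hsum, ← lintegral_neg_eq_self (μ := (volume : Measure ℝ))]
  refine lintegral_mono fun t => lintegral_mono fun x => lintegral_mono fun y =>
    lintegral_mono fun z => ?_
  have hsym := abs_symbol_le hs h hε hε1 hN x y z
  have hj : ∀ v : Rn 3, 0 ≤ jap v ^ (1/2 - ε/2) := fun v => Real.rpow_nonneg (jap_pos v).le _
  have hji : ∀ v : Rn 3, 0 ≤ (jap v)⁻¹ := fun v => inv_nonneg.2 (jap_pos v).le
  have hN0 : 0 < N := by linarith
  have hsymE : ‖((1 - mN m₁ N (x + y + z) /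
      (mN m₁ N x * mN m₁ N y * mN m₁ N z) : ℝ) : ℂ)‖ₑ ≤
      c * (ENNReal.ofReal (jap (-x - y - z) ^ (1/2 - ε/2) * (jap (-x - y - z))⁻¹) *
        (ENNReal.ofReal (jap x ^ (1/2 - ε/2) * ‖x‖) +
          (ENNReal.ofReal (jap y ^ (1/2 - ε/2) * ‖y‖) +
          ENNReal.ofReal (jap z ^ (1/2 - ε/2) * ‖z‖)))) := by
    have p : ∀ v : Rn 3, 0 ≤ jap v ^ (1/2 - ε/2) * ‖v‖ := fun v => mul_nonneg (hj v) (norm_nonneg v)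
    rw [hc, ← ENNReal.ofReal_add (p y) (p z), ← ENNReal.ofReal_add (p x) (add_nonneg (p y) (p z)),
      ← ENNReal.ofReal_mul (mul_nonneg (hj _) (hji _)), ← ENNReal.ofReal_mul (by positivity),
      ← ofReal_norm, Complex.norm_real, Real.norm_eq_abs]
    refine ENNReal.ofReal_le_ofReal (hsym.trans (le_of_eq ?_))
    ring
  simp only [enorm_mul, enorm_fourier_slice, hA, hA₂, hA₃, hA₄, hB₂, hB₃, hB₄, weightedTimeFourier]
  refine (mul_le_mul_left (mul_le_mul_left (mul_le_mul_left (mul_le_mul_left hsymE _) _) _) _).trans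
    (le_of_eq ?_)
  ring_nf

lemma le_of_sq_le_prod_sq {a K b : ENNReal} {x₁ x₂ x₃ x₄ : ℝ}
    (h₁ : 0 ≤ x₁) (h₂ : 0 ≤ x₂) (h₃ : 0 ≤ x₃) (h₄ : 0 ≤ x₄) (h : a ^ 2 ≤ K ^ 2 * b)
    (hb : b ≤ ENNReal.ofReal (x₁ ^ 2) * ENNReal.ofReal (x₂ ^ 2) * ENNReal.ofReal (x₃ ^ 2) *
      ENNReal.ofReal (x₄ ^ 2)) :
    a ≤ K * ENNReal.ofReal (x₁ * x₂ * x₃ * x₄) := by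
  rw [← ENNReal.rpow_le_rpow_iff (z := (2 : ℕ)) (by norm_num), ENNReal.rpow_natCast,
    ENNReal.rpow_natCast, mul_pow]
  refine h.trans (mul_le_mul' le_rfl (hb.trans (le_of_eq ?_)))
  rw [← ENNReal.ofReal_mul (by positivity), ← ENNReal.ofReal_mul (by positivity),
    ← ENNReal.ofReal_mul (by positivity), ← mul_pow, ← mul_pow, ← mul_pow,
    ENNReal.ofReal_pow (by positivity)]

/-- Commutator quadrilinear estimate in ℝ^{3+1} (summed form). -/
theorem statement_19 :
    ∀ s : ℝ, 5/6 < s → s < 1 →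
    ∀ m₁ : Rn 3 → ℝ, IsAdmissibleMultiplier 3 s m₁ →
    ∃ ε₀ > (0:ℝ), ∀ ε : ℝ, 0 < ε → ε < ε₀ →
    ∃ C > (0:ℝ),
    ∀ N : ℝ, 1 ≤ N → ∀ δ : ℝ, 0 < δ → δ ≤ 1 →
    ∀ φ₁ φ₂ φ₃ φ₄ : SchwartzMap (Rn 3 × ℝ) ℂ,
    (∀ t : ℝ, ∀ ξ : Rn 3,
        0 ≤ (𝓕 (fun x => φ₁ (x, t)) ξ).re ∧ (𝓕 (fun x => φ₁ (x, t)) ξ).im = 0) →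
    (∀ t : ℝ, ∀ ξ : Rn 3,
        0 ≤ (𝓕 (fun x => φ₂ (x, t)) ξ).re ∧ (𝓕 (fun x => φ₂ (x, t)) ξ).im = 0) →
    (∀ t : ℝ, ∀ ξ : Rn 3,
        0 ≤ (𝓕 (fun x => φ₃ (x, t)) ξ).re ∧ (𝓕 (fun x => φ₃ (x, t)) ξ).im = 0) →
    (∀ t : ℝ, ∀ ξ : Rn 3,
        0 ≤ (𝓕 (fun x => φ₄ (x, t)) ξ).re ∧ (𝓕 (fun x => φ₄ (x, t)) ξ).im = 0) →
    ‖∫ t in Icc (0:ℝ) δ, ∫ ξ₂ : Rn 3, ∫ ξ₃ : Rn 3, ∫ ξ₄ : Rn 3,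
        ((1 - mN m₁ N (ξ₂ + ξ₃ + ξ₄) /
            (mN m₁ N ξ₂ * mN m₁ N ξ₃ * mN m₁ N ξ₄) : ℝ) : ℂ) *
          𝓕 (fun x => φ₁ (x, t)) (-ξ₂ - ξ₃ - ξ₄) *
          𝓕 (fun x => φ₂ (x, t)) ξ₂ *
          𝓕 (fun x => φ₃ (x, t)) ξ₃ *
          𝓕 (fun x => φ₄ (x, t)) ξ₄‖
      ≤ C * N ^ (-(1:ℝ) + ε) *
          XNorm 3 (-1) (1/2 + ε) (fun x t => φ₁ (x, t)) *
          XNorm 3 0 (1/2 + ε) (fun x t => gradC (fun y => φ₂ (y, t)) x) *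
          XNorm 3 0 (1/2 + ε) (fun x t => gradC (fun y => φ₃ (y, t)) x) *
          XNorm 3 0 (1/2 + ε) (fun x t => gradC (fun y => φ₄ (y, t)) x) := by
  intro s hs _ m₁ hm
  refine ⟨1/2, by norm_num, fun ε hε hε1 => ?_⟩
  obtain ⟨K, hK, hquad⟩ := exists_quadForm_sq_le (q := 1 + 2 * ε) (θ := ε/2) (by linarith)
    (by linarith) (by linarith)
  refine ⟨432 * (K.toReal + 1), by positivity, ?_⟩
  intro N hN δ _ _ φ₁ φ₂ φ₃ φ₄ h₁ h₂ h₃ h₄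
  have n₁ := nonnegTimeFourier_stFourierSchwartz h₁
  have n₂ := nonnegTimeFourier_stFourierSchwartz h₂
  have n₃ := nonnegTimeFourier_stFourierSchwartz h₃
  have n₄ := nonnegTimeFourier_stFourierSchwartz h₄
  have hN0 : 0 < N := by linarith
  have hmain := enorm_commutator_le hs hm hε hε1 hN (Icc 0 δ) φ₁ φ₂ φ₃ φ₄ rfl rfl rfl rfl rfl
    rfl rfl
  have mA := n₁.1.measurable_weightedTimeFourier (θ := ε/2) continuous_inv_jap
  have mB₃ := n₃.1.measurable_weightedTimeFourier (θ := ε/2) continuous_norm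
  have mB₄ := n₄.1.measurable_weightedTimeFourier (θ := ε/2) continuous_norm
  rw [quadForm_swap_left mA n₂.1.measurable_timeFourier mB₃ n₄.1.measurable_timeFourier,
    quadForm_swap_right mA n₃.1.measurable_timeFourier mB₄,
    quadForm_swap_left mA n₂.1.measurable_timeFourier mB₄ n₃.1.measurable_timeFourier] at hmain
  have w₁ := (wL2_inv_jap hε1 φ₁).le
  have w₂ := wL2_norm_le hε1 φ₂
  have w₃ := wL2_norm_le hε1 φ₃
  have w₄ := wL2_norm_le hε1 φ₄
  have z₁ := XNorm_nonneg (-1) (1/2 + ε) (fun x t => φ₁ (x, t))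
  have z₂ := XNorm_nonneg 0 (1/2 + ε) (fun x t => gradC (fun y => φ₂ (y, t)) x)
  have z₃ := XNorm_nonneg 0 (1/2 + ε) (fun x t => gradC (fun y => φ₃ (y, t)) x)
  have z₄ := XNorm_nonneg 0 (1/2 + ε) (fun x t => gradC (fun y => φ₄ (y, t)) x)
  set x₁ := XNorm 3 (-1) (1/2 + ε) (fun x t => φ₁ (x, t))
  set x₂ := XNorm 3 0 (1/2 + ε) (fun x t => gradC (fun y => φ₂ (y, t)) x)
  set x₃ := XNorm 3 0 (1/2 + ε) (fun x t => gradC (fun y => φ₃ (y, t)) x)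
  set x₄ := XNorm 3 0 (1/2 + ε) (fun x t => gradC (fun y => φ₄ (y, t)) x)
  have q₂ := le_of_sq_le_prod_sq z₁ z₂ z₃ z₄ (hquad _ _ _ _ n₁ n₂ n₃ n₄)
    (by gcongr)
  have q₃ := le_of_sq_le_prod_sq z₁ z₃ z₂ z₄ (hquad _ _ _ _ n₁ n₃ n₂ n₄)
    (by gcongr)
  have q₄ := le_of_sq_le_prod_sq z₁ z₄ z₂ z₃ (hquad _ _ _ _ n₁ n₄ n₂ n₃)
    (by gcongr)
  rw [show x₁ * x₃ * x₂ * x₄ = x₁ * x₂ * x₃ * x₄ by ring] at q₃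
  rw [show x₁ * x₄ * x₂ * x₃ = x₁ * x₂ * x₃ * x₄ by ring] at q₄
  have hfin := hmain.trans (mul_le_mul' le_rfl (add_le_add (add_le_add q₂ q₃) q₄))
  rw [← ENNReal.ofReal_toReal hK.ne, ← ENNReal.ofReal_mul ENNReal.toReal_nonneg,
    ← ENNReal.ofReal_add (by positivity) (by positivity),
    ← ENNReal.ofReal_add (by positivity) (by positivity),
    ← ENNReal.ofReal_mul (by positivity), ← ofReal_norm,
    ENNReal.ofReal_le_ofReal_iff (by positivity)] at hfin
  refine hfin.trans ?_
  have hp : 0 ≤ 432 * (N ^ (-1 + ε) * (x₁ * x₂ * x₃ * x₄)) := by positivity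
  linarith

end
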